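/- arXiv:2205.03728 — 9 statements merged into one kernel-verified Lean document; each statement's English description precedes it below -/
import Mathlib

section
/- Let H be a class of experts h: X → [0,1] on a feature space X and let T be a time horizon. Suppose that for every α ∈ (0,1) there exists a finite, nonempty global sequential α-covering set G_α of H at scale T. Then the sequential minimax regret under logarithmic loss satisfies r^a_T(H) ≤ inf_{0<α<1} ( 2·α·T + log|G_α| ). -/
open Set

/-- Logarithmic loss `ℓ(ŷ,y) = -y log ŷ - (1-y) log(1-ŷ)` with values in `EReal`
(the loss is `⊤` when the predicted probability of the realized label is `0`). -/
noncomputable def logLoss (p : ℝ) (y : Bool) : EReal :=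
  if y then (if p = 0 then ⊤ else (((-Real.log p : ℝ)) : EReal))
  else (if p = 1 then ⊤ else (((-Real.log (1 - p) : ℝ)) : EReal))

/-- Accumulated loss of the learner's predictions `ps` against labels `ys`. -/
noncomputable def lossSum (ps : List ℝ) (ys : List Bool) : EReal :=
  (List.zipWith logLoss ps ys).sum

/-- Accumulated loss of expert `h` on features `xs` against labels `ys`. -/
noncomputable def expertLoss {X : Type*} (h : X → ℝ) (xs : List X) (ys : List Bool) : EReal :=
  (List.zipWith (fun x y => logLoss (h x) y) xs ys).sum

/-- Pointwise regret `R(ŷ^T, y^T, H | x^T)`. -/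
noncomputable def pointwiseRegret {X : Type*} (H : Set (X → ℝ))
    (xs : List X) (ps : List ℝ) (ys : List Bool) : EReal :=
  lossSum ps ys - ⨅ h ∈ H, expertLoss h xs ys

/-- Game value of the sequential prediction game with `n` rounds remaining, where
`xs`, `ps`, `ys` record the features, predictions and labels so far:
`sup_x inf_{ŷ ∈ [0,1]} sup_{y ∈ {0,1}} ⋯` of the final pointwise regret. -/
noncomputable def seqRegretAux {X : Type*} (H : Set (X → ℝ)) :
    ℕ → List X → List ℝ → List Bool → EReal
  | 0, xs, ps, ys => pointwiseRegret H xs ps ys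
  | n+1, xs, ps, ys =>
      ⨆ x : X, ⨅ p : Set.Icc (0:ℝ) 1, ⨆ y : Bool,
        seqRegretAux H n (xs ++ [x]) (ps ++ [(p : ℝ)]) (ys ++ [y])

/-- Sequential (agnostic) minimax regret `r^a_T(H)`. -/
noncomputable def seqRegret {X : Type*} (H : Set (X → ℝ)) (T : ℕ) : EReal :=
  seqRegretAux H T [] [] []

/-- `G` is a global sequential `α`-covering of `H` at scale `T`: for every feature
sequence `x^T` and every `h ∈ H` there is `g ∈ G` with `|h(x_t) - g(x^t)| ≤ α`
for all `t ∈ {1,…,T}` (here `t : Fin T` is the 0-indexed round, and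
`(List.ofFn x).take (t+1)` is the prefix `x^t`). -/
def IsGlobalSeqCover {X : Type*} (T : ℕ) (H : Set (X → ℝ))
    (G : Set (List X → ℝ)) (α : ℝ) : Prop :=
  ∀ x : Fin T → X, ∀ h ∈ H, ∃ g ∈ G, ∀ t : Fin T,
    |h (x t) - g ((List.ofFn x).take (t.1 + 1))| ≤ α

/-- The probability assigned to the label `y` by the prediction `q`. -/
def labelProb (q : ℝ) (y : Bool) : ℝ := if y then q else 1 - q

/-- The prediction `b` moved away from `0` and `1` by an amount controlled by `α`. -/
noncomputable def smoothPred (α b : ℝ) : ℝ := (b + α) / (1 + 2 * α)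

lemma logLoss_eq_of_labelProb_pos {q : ℝ} {y : Bool} (h : 0 < labelProb q y) :
    logLoss q y = ((-Real.log (labelProb q y) : ℝ) : EReal) := by
  cases y
  · have h1 : q ≠ 1 := by rintro rfl; simp [labelProb] at h
    simp [logLoss, labelProb, h1]
  · have h0 : q ≠ 0 := by rintro rfl; simp [labelProb] at h
    simp [logLoss, labelProb, h0]

lemma logLoss_eq_top_of_labelProb_eq_zero {q : ℝ} {y : Bool} (h : labelProb q y = 0) :
    logLoss q y = ⊤ := by
  cases y
  · have h1 : q = 1 := by simp [labelProb] at h; linarith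
    simp [logLoss, h1]
  · have h0 : q = 0 := by simpa [labelProb] using h
    simp [logLoss, h0]

lemma labelProb_nonneg {q : ℝ} (hq : q ∈ Icc (0 : ℝ) 1) (y : Bool) : 0 ≤ labelProb q y := by
  cases y
  · simpa [labelProb] using hq.2
  · simpa [labelProb] using hq.1

lemma labelProb_smoothPred {α : ℝ} (hα : 0 < α) (b : ℝ) (y : Bool) :
    labelProb (smoothPred α b) y = (labelProb b y + α) / (1 + 2 * α) := by
  have : (1 + 2 * α) ≠ 0 := by positivity
  cases y
  · simp only [labelProb, smoothPred, Bool.false_eq_true, if_false]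
    field_simp
    ring
  · simp [labelProb, smoothPred]

lemma labelProb_smoothPred_pos {α b : ℝ} (hα : 0 < α) (hb : b ∈ Icc (0 : ℝ) 1) (y : Bool) :
    0 < labelProb (smoothPred α b) y := by
  rw [labelProb_smoothPred hα]
  have := labelProb_nonneg hb y
  positivity

lemma labelProb_le_add_of_abs_sub_le {α a b : ℝ} (hab : |a - b| ≤ α) (y : Bool) :
    labelProb a y ≤ labelProb b y + α := by
  obtain ⟨h1, h2⟩ := abs_le.1 hab
  cases y <;> simp [labelProb] <;> linarith

/-- Smoothing costs at most `2 α` in logarithmic loss against any `α`-close prediction. -/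
lemma neg_log_labelProb_smoothPred_le {α a b : ℝ} (hα : 0 < α) (ha : a ∈ Icc (0 : ℝ) 1)
    (hab : |a - b| ≤ α) (y : Bool) :
    ((-Real.log (labelProb (smoothPred α b) y) : ℝ) : EReal)
      ≤ logLoss a y + ((2 * α : ℝ) : EReal) := by
  rcases (labelProb_nonneg ha y).eq_or_lt with h0 | hpos
  · rw [logLoss_eq_top_of_labelProb_eq_zero h0.symm, EReal.top_add_coe]
    exact le_top
  · rw [logLoss_eq_of_labelProb_pos hpos, ← EReal.coe_add, EReal.coe_le_coe_iff,
      labelProb_smoothPred hα]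
    have hle := labelProb_le_add_of_abs_sub_le hab y
    have hd : (0 : ℝ) < 1 + 2 * α := by positivity
    rw [Real.log_div (by linarith) hd.ne']
    have h1 := Real.log_le_log hpos hle
    have h2 := Real.log_le_sub_one_of_pos hd
    linarith

lemma lossSum_concat {ps : List ℝ} {ys : List Bool} (hl : ps.length = ys.length)
    (p : ℝ) (y : Bool) :
    lossSum (ps ++ [p]) (ys ++ [y]) = lossSum ps ys + logLoss p y := by
  simp [lossSum, List.zipWith_append hl]

lemma expertLoss_concat {X : Type*} (h : X → ℝ) {xs : List X} {ys : List Bool}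
    (hl : xs.length = ys.length) (x : X) (y : Bool) :
    expertLoss h (xs ++ [x]) (ys ++ [y]) = expertLoss h xs ys + logLoss (h x) y := by
  simp [expertLoss, List.zipWith_append hl]

/-- `g` predicts within `α` of `h` along all the prefixes of `xs`. -/
def IsCloseAlong {X : Type*} (α : ℝ) (h : X → ℝ) (g : List X → ℝ) (xs : List X) : Prop :=
  ∀ t : Fin xs.length, |h (xs.get t) - g (xs.take (t.1 + 1))| ≤ α

lemma IsCloseAlong.of_concat {X : Type*} {α : ℝ} {h : X → ℝ} {g : List X → ℝ} {xs : List X}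
    {x : X} (H : IsCloseAlong α h g (xs ++ [x])) :
    IsCloseAlong α h g xs ∧ |h x - g (xs ++ [x])| ≤ α := by
  refine ⟨fun t => ?_, ?_⟩
  · have ht := t.2
    have := H ⟨t.1, by simp⟩
    simpa [List.getElem_append_left ht, List.take_append_of_le_length (Nat.succ_le_of_lt ht)]
      using this
  · have := H ⟨xs.length, by simp⟩
    have htake : (xs ++ [x]).take (xs.length + 1) = xs ++ [x] :=
      List.take_of_length_le (by simp)
    simpa [htake] using this

/-- Regret bound for the Bayesian mixture, started from a position where the learner's
accumulated loss is that of the mixture with unnormalized posterior weights `w`. -/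
lemma seqRegretAux_le_of_mixture {X : Type*} {T : ℕ} {H : Set (X → ℝ)}
    (hH : ∀ h ∈ H, ∀ x, h x ∈ Icc (0 : ℝ) 1) {S : Finset (List X → ℝ)} (hS : S.Nonempty)
    (hrange : ∀ g ∈ S, ∀ l, g l ∈ Icc (0 : ℝ) 1) {α : ℝ} (hα : 0 < α)
    (hcov : IsGlobalSeqCover T H S α) (n : ℕ) :
    ∀ (xs : List X) (ps : List ℝ) (ys : List Bool) (w : (List X → ℝ) → ℝ),
      xs.length + n = T → xs.length = ys.length → ps.length = ys.length →
      (∀ g ∈ S, 0 < w g) →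
      lossSum ps ys = ((-Real.log (∑ g ∈ S, w g) + Real.log S.card : ℝ) : EReal) →
      (∀ h ∈ H, ∀ g ∈ S, IsCloseAlong α h g xs →
        ((-Real.log (w g) : ℝ) : EReal)
          ≤ expertLoss h xs ys + ((2 * α * xs.length : ℝ) : EReal)) →
      seqRegretAux H n xs ps ys ≤ ((2 * α * T + Real.log S.card : ℝ) : EReal) := by
  induction n with
  | zero =>
    intro xs ps ys w hT _ _ hw hloss hexp
    rw [add_zero] at hT
    subst hT
    rw [seqRegretAux, pointwiseRegret, hloss]
    refine EReal.sub_le_of_le_add' ?_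
    rw [← EReal.sub_le_iff_le_add (.inl (EReal.coe_ne_bot _)) (.inl (EReal.coe_ne_top _))]
    refine le_iInf₂ fun h hh => ?_
    rw [EReal.sub_le_iff_le_add (.inl (EReal.coe_ne_bot _)) (.inl (EReal.coe_ne_top _))]
    obtain ⟨g, hg, hclose⟩ := hcov xs.get h hh
    rw [List.ofFn_get] at hclose
    have hlog : Real.log (w g) ≤ Real.log (∑ g ∈ S, w g) :=
      Real.log_le_log (hw g hg)
        (Finset.single_le_sum (f := w) (fun i hi => (hw i hi).le) hg)
    calc ((-Real.log (∑ g ∈ S, w g) + Real.log S.card : ℝ) : EReal)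
        ≤ ((-Real.log (w g) + Real.log S.card : ℝ) : EReal) := by
          rw [EReal.coe_le_coe_iff]; linarith
      _ = ((-Real.log (w g) : ℝ) : EReal) + ((Real.log S.card : ℝ) : EReal) :=
          EReal.coe_add _ _
      _ ≤ _ := add_le_add_left (hexp h hh g hg hclose) _
      _ = _ := by rw [add_assoc, ← EReal.coe_add]
  | succ n ih =>
    intro xs ps ys w hT hxy hpy hw hloss hexp
    rw [seqRegretAux]
    refine iSup_le fun x => ?_
    have hZ : 0 < ∑ g ∈ S, w g := Finset.sum_pos hw hS
    set q : (List X → ℝ) → ℝ := fun g => smoothPred α (g (xs ++ [x])) with hq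
    have hqpos : ∀ g ∈ S, ∀ y, 0 < labelProb (q g) y := fun g hg y =>
      labelProb_smoothPred_pos hα (hrange g hg _) y
    set p : ℝ := (∑ g ∈ S, w g * q g) / ∑ g ∈ S, w g with hp
    have hprob : ∀ y, labelProb p y = (∑ g ∈ S, w g * labelProb (q g) y) / ∑ g ∈ S, w g := by
      intro y
      cases y
      · simp only [labelProb, Bool.false_eq_true, if_false, mul_sub, mul_one,
          Finset.sum_sub_distrib, sub_div, div_self hZ.ne', hp]
      · simp [labelProb, hp]
    have hw' : ∀ y, ∀ g ∈ S, 0 < w g * labelProb (q g) y := fun y g hg =>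
      mul_pos (hw g hg) (hqpos g hg y)
    have hZ' : ∀ y, 0 < ∑ g ∈ S, w g * labelProb (q g) y := fun y =>
      Finset.sum_pos (hw' y) hS
    have hppos : ∀ y, 0 < labelProb p y := fun y => by
      rw [hprob]; exact div_pos (hZ' y) hZ
    have hpmem : p ∈ Icc (0 : ℝ) 1 := by
      have h1 := hppos true
      have h2 := hppos false
      simp only [labelProb, if_true, Bool.false_eq_true, if_false] at h1 h2
      exact ⟨h1.le, by linarith⟩
    refine iInf_le_of_le ⟨p, hpmem⟩ (iSup_le fun y => ?_)
    refine ih _ _ _ (fun g => w g * labelProb (q g) y) ?_ (by simp [hxy]) (by simp [hpy])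
      (hw' y) ?_ ?_
    · simp only [List.length_append, List.length_singleton]; omega
    · rw [lossSum_concat hpy, hloss, logLoss_eq_of_labelProb_pos (hppos y), ← EReal.coe_add,
        hprob, Real.log_div (hZ' y).ne' hZ.ne']
      congr 1
      ring
    · intro h hh g hg hclose
      obtain ⟨hprev, hlast⟩ := hclose.of_concat
      rw [expertLoss_concat h hxy, Real.log_mul (hw g hg).ne' (hqpos g hg y).ne', neg_add,
        EReal.coe_add]
      refine (add_le_add (hexp h hh g hg hprev)
        (neg_log_labelProb_smoothPred_le hα (hH h hh x) hlast y)).trans_eq ?_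
      rw [add_add_add_comm, ← EReal.coe_add]
      congr 2
      simp only [List.length_append, List.length_singleton, Nat.cast_add, Nat.cast_one]
      ring

/-- Theorem 1: if for every `α ∈ (0,1)` there is a finite nonempty global sequential
`α`-covering set `G α` of `H` at scale `T`, then
`r^a_T(H) ≤ inf_{0<α<1} (2 α T + log |G α|)`. -/
theorem seqRegret_le_iInf_cover {X : Type*} (T : ℕ)
    (H : Set (X → ℝ)) (hH : ∀ h ∈ H, ∀ x, h x ∈ Set.Icc (0:ℝ) 1)
    (G : ℝ → Set (List X → ℝ))
    (hGfin : ∀ α ∈ Set.Ioo (0:ℝ) 1, (G α).Finite)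
    (hGne : ∀ α ∈ Set.Ioo (0:ℝ) 1, (G α).Nonempty)
    (hGrange : ∀ α ∈ Set.Ioo (0:ℝ) 1, ∀ g ∈ G α, ∀ l, g l ∈ Set.Icc (0:ℝ) 1)
    (hGcov : ∀ α ∈ Set.Ioo (0:ℝ) 1, IsGlobalSeqCover T H (G α) α) :
    seqRegret H T ≤
      ⨅ α ∈ Set.Ioo (0:ℝ) 1,
        ((2 * α * (T : ℝ) + Real.log (Nat.card (G α)) : ℝ) : EReal) := by
  refine le_iInf₂ fun α hα => ?_
  have hcard : Nat.card (G α) = (hGfin α hα).toFinset.card :=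
    Nat.card_eq_card_finite_toFinset (hGfin α hα)
  have hne : (hGfin α hα).toFinset.Nonempty := by simpa using hGne α hα
  rw [hcard]
  refine seqRegretAux_le_of_mixture hH hne
    (fun g hg => hGrange α hα g (by simpa using hg)) hα.1 (by simpa using hGcov α hα) T
    [] [] [] (fun _ => 1) (by simp) rfl rfl (fun _ _ => one_pos) ?_ ?_
  · simp [lossSum]
  · intro h _ g _ _
    simp [expertLoss]
end

section
/- Let d, T be positive integers, s ≥ 1, and R, L > 0. Let f: B_s^d(R) × ℝ^d → [0,1] satisfy |f(w₁,x) − f(w₂,x)| ≤ L·‖w₁ − w₂‖_s for all w₁, w₂ ∈ B_s^d(R) and all x ∈ ℝ^d, where B_s^d(R) is the ℓ_s-ball of radius R in ℝ^d centered at the origin. Let H_f = { f(w,·) : w ∈ B_s^d(R) } with feature space X = ℝ^d. Then the sequential minimax regret under logarithmic loss satisfies r^a_T(H_f) ≤ min{ d·log(2RLT/d + 1) + 2d, T }. -/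
open Set

/-- The `ℓ_s` norm on `ℝ^d`. -/
noncomputable def lsNorm (s : ℝ) {d : ℕ} (w : Fin d → ℝ) : ℝ :=
  (∑ i, |w i| ^ s) ^ (1 / s)

open MeasureTheory Metric Module in
open scoped Function in
/-- An `r`-separated set in the closed ball of radius `R` of a finite-dimensional normed space has
cardinality at most `(2 * R / r + 1) ^ dim`. -/
theorem card_le_of_separated_of_norm_le {E : Type*} [NormedAddCommGroup E] [NormedSpace ℝ E]
    [FiniteDimensional ℝ E] {R r : ℝ} (hR : 0 ≤ R) (hr : 0 < r) (s : Finset E)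
    (hs : ∀ c ∈ s, ‖c‖ ≤ R) (h : ∀ c ∈ s, ∀ d ∈ s, c ≠ d → r ≤ ‖c - d‖) :
    (s.card : ℝ) ≤ (2 * R / r + 1) ^ finrank ℝ E := by
  borelize E
  let μ : Measure E := Measure.addHaar
  have hr2 : 0 < r / 2 := half_pos hr
  have hρ : 0 < R + r / 2 := by positivity
  have hdisj : Set.Pairwise (s : Set E) (Disjoint on fun c => ball (c : E) (r / 2)) := by
    rintro c hc d hd hcd
    apply ball_disjoint_ball
    rw [dist_eq_norm, add_halves]
    exact h c hc d hd hcd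
  have hsub : (⋃ c ∈ s, ball (c : E) (r / 2)) ⊆ ball (0 : E) (R + r / 2) := by
    refine Set.iUnion₂_subset fun x hx => ball_subset_ball' ?_
    rw [dist_zero_right]
    linarith [hs x hx]
  have hμ : (s.card : ENNReal) * ENNReal.ofReal ((r / 2) ^ finrank ℝ E) * μ (ball 0 1) ≤
      ENNReal.ofReal ((R + r / 2) ^ finrank ℝ E) * μ (ball 0 1) := by
    have hle := measure_mono (μ := μ) hsub
    rw [measure_biUnion_finset hdisj fun c _ => measurableSet_ball] at hle
    simpa only [μ.addHaar_ball_of_pos _ hr2, μ.addHaar_ball_of_pos _ hρ, Finset.sum_const,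
      nsmul_eq_mul, mul_assoc] using hle
  have hcard : (s.card : ENNReal) * ENNReal.ofReal ((r / 2) ^ finrank ℝ E) ≤
      ENNReal.ofReal ((R + r / 2) ^ finrank ℝ E) :=
    (ENNReal.mul_le_mul_iff_left (measure_ball_pos _ _ zero_lt_one).ne' measure_ball_lt_top.ne).1 hμ
  have hreal := ENNReal.toReal_le_of_le_ofReal (pow_nonneg hρ.le _) hcard
  rw [ENNReal.toReal_mul, ENNReal.toReal_natCast, ENNReal.toReal_ofReal (by positivity),
    ← le_div_iff₀ (by positivity), ← div_pow] at hreal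
  refine hreal.trans_eq ?_
  congr 1
  field_simp

/-- The closed ball of radius `R` in a finite-dimensional normed space has an `r`-net of cardinality
at most `(2 * R / r + 1) ^ dim`, with all its points in the ball. -/
theorem exists_finset_net_closedBall (E : Type*) [NormedAddCommGroup E] [NormedSpace ℝ E]
    [FiniteDimensional ℝ E] {R r : ℝ} (hR : 0 ≤ R) (hr : 0 < r) :
    ∃ s : Finset E, s.Nonempty ∧ (s.card : ℝ) ≤ (2 * R / r + 1) ^ Module.finrank ℝ E ∧
      (∀ c ∈ s, ‖c‖ ≤ R) ∧ ∀ w : E, ‖w‖ ≤ R → ∃ c ∈ s, ‖w - c‖ ≤ r := by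
  classical
  let P : Finset E → Prop := fun s =>
    (∀ c ∈ s, ‖c‖ ≤ R) ∧ ∀ c ∈ s, ∀ d ∈ s, c ≠ d → r ≤ ‖c - d‖
  let S : Set ℕ := {n | ∃ s : Finset E, P s ∧ s.card = n}
  have hbdd : BddAbove S := by
    refine ⟨⌊(2 * R / r + 1) ^ Module.finrank ℝ E⌋₊, ?_⟩
    rintro n ⟨s, hs, rfl⟩
    exact Nat.le_floor (card_le_of_separated_of_norm_le hR hr s hs.1 hs.2)
  obtain ⟨s, hs, hcard⟩ : sSup S ∈ S :=
    Nat.sSup_mem ⟨0, ∅, ⟨by simp, by simp⟩, rfl⟩ hbdd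
  have hnet : ∀ w : E, ‖w‖ ≤ R → ∃ c ∈ s, ‖w - c‖ ≤ r := by
    intro w hw
    by_contra! hfar
    have hws : w ∉ s := fun hmem => by
      have := hfar w hmem
      rw [sub_self, norm_zero] at this
      linarith
    have hins : P (insert w s) := by
      refine ⟨fun c hc => ?_, fun c hc d hd hcd => ?_⟩
      · rcases Finset.mem_insert.1 hc with rfl | hcs
        exacts [hw, hs.1 c hcs]
      · rcases Finset.mem_insert.1 hc with rfl | hcs <;>
          rcases Finset.mem_insert.1 hd with rfl | hds
        · exact absurd rfl hcd
        · exact (hfar d hds).le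
        · rw [norm_sub_rev]
          exact (hfar c hcs).le
        · exact hs.2 c hcs d hds hcd
    have hle := le_csSup hbdd ⟨insert w s, hins, rfl⟩
    rw [Finset.card_insert_of_notMem hws, ← hcard] at hle
    omega
  refine ⟨s, ?_, card_le_of_separated_of_norm_le hR hr s hs.1 hs.2, hs.1, hnet⟩
  obtain ⟨c, hc, -⟩ := hnet 0 (by simpa using hR)
  exact ⟨c, hc⟩

/-- If the experts admit a positive probability assignment `W` to label sequences, whose negative
logarithm is at most `B` plus the loss of any expert, then the regret is at most `B`. -/
theorem seqRegret_le_of_assignment {X : Type*} (H : Set (X → ℝ)) (T : ℕ) (B : ℝ)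
    (W : List X → List Bool → ℝ) (hpos : ∀ xs ys, 0 < W xs ys) (hnil : W [] [] = 1)
    (hadd : ∀ xs ys x, xs.length = ys.length →
      W (xs ++ [x]) (ys ++ [true]) + W (xs ++ [x]) (ys ++ [false]) = W xs ys)
    (hB : ∀ xs ys, xs.length = T → ys.length = T → ∀ h ∈ H,
      ((-Real.log (W xs ys) : ℝ) : EReal) ≤ (B : EReal) + expertLoss h xs ys) :
    seqRegret H T ≤ (B : EReal) := by
  suffices key : ∀ n xs ps ys, xs.length + n = T → ps.length = xs.length →
      ys.length = xs.length → lossSum ps ys = ((-Real.log (W xs ys) : ℝ) : EReal) →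
      seqRegretAux H n xs ps ys ≤ (B : EReal) by
    exact key T [] [] [] (by simp) rfl rfl (by simp [lossSum, hnil])
  intro n
  induction n with
  | zero =>
    intro xs ps ys hT hps hys hloss
    rw [seqRegretAux, pointwiseRegret, hloss]
    refine EReal.sub_le_of_le_add ?_
    rw [add_comm, ← EReal.sub_le_iff_le_add (by simp) (by simp)]
    refine le_iInf₂ fun h hh => ?_
    rw [EReal.sub_le_iff_le_add (by simp) (by simp), add_comm]
    exact hB xs ys hT (hys.trans hT) h hh
  | succ n ih =>
    intro xs ps ys hT hps hys hloss
    rw [seqRegretAux]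
    refine iSup_le fun x => ?_
    have h0 := hpos xs ys
    have h1 := hpos (xs ++ [x]) (ys ++ [true])
    have h2 := hpos (xs ++ [x]) (ys ++ [false])
    have h3 := hadd xs ys x hys.symm
    set p : ℝ := W (xs ++ [x]) (ys ++ [true]) / W xs ys with hp
    have hp0 : 0 < p := div_pos h1 h0
    have hq : 1 - p = W (xs ++ [x]) (ys ++ [false]) / W xs ys := by
      rw [hp]
      field_simp
      linarith
    have hp1 : 0 < 1 - p := hq ▸ div_pos h2 h0
    refine iInf_le_of_le ⟨p, hp0.le, by linarith⟩ (iSup_le fun y => ih _ _ _ ?_ ?_ ?_ ?_)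
    · simp only [List.length_append, List.length_singleton]
      omega
    · simp [hps]
    · simp [hys]
    · have hstep : lossSum (ps ++ [p]) (ys ++ [y]) = lossSum ps ys + logLoss p y := by
        simp [lossSum, List.zipWith_append (hps.trans hys.symm)]
      rw [hstep, hloss]
      cases y with
      | true =>
        rw [logLoss, if_pos rfl, if_neg hp0.ne', ← EReal.coe_add, hp, Real.log_div h1.ne' h0.ne']
        congr 1
        ring
      | false =>
        rw [logLoss, if_neg (by simp), if_neg (by linarith), ← EReal.coe_add, hq,
          Real.log_div h2.ne' h0.ne']
        congr 1
        ring

/-- The probability an expert `g` assigns to the labels `ys` on the features `xs`. -/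
noncomputable def expertLikelihood {X : Type*} (g : X → ℝ) (xs : List X) (ys : List Bool) : ℝ :=
  (List.zipWith (fun x y => if y then g x else 1 - g x) xs ys).prod

theorem expertLikelihood_pos {X : Type*} {g : X → ℝ} (hg : ∀ x, g x ∈ Ioo (0 : ℝ) 1) :
    ∀ (xs : List X) (ys : List Bool), 0 < expertLikelihood g xs ys
  | [], _ => by simp [expertLikelihood]
  | _ :: _, [] => by simp [expertLikelihood]
  | x :: xs, y :: ys => by
    have ih := expertLikelihood_pos hg xs ys
    rw [expertLikelihood] at ih ⊢
    rw [List.zipWith_cons_cons, List.prod_cons]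
    refine mul_pos ?_ ih
    split_ifs
    exacts [(hg x).1, sub_pos.2 (hg x).2]

theorem expertLikelihood_append_singleton {X : Type*} (g : X → ℝ) {xs : List X} {ys : List Bool}
    (hlen : xs.length = ys.length) (x : X) (y : Bool) :
    expertLikelihood g (xs ++ [x]) (ys ++ [y]) =
      expertLikelihood g xs ys * if y then g x else 1 - g x := by
  simp [expertLikelihood, List.zipWith_append hlen]

theorem neg_log_le_add_logLoss {p q c : ℝ} (hq : q ∈ Ioo (0 : ℝ) 1) (hp : p ∈ Icc (0 : ℝ) 1)
    (hc : 0 < c) (h₁ : p ≤ c * q) (h₀ : 1 - p ≤ c * (1 - q)) (y : Bool) :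
    ((-Real.log (if y then q else 1 - q) : ℝ) : EReal) ≤ (Real.log c : EReal) + logLoss p y := by
  have aux : ∀ a b : ℝ, 0 < a → 0 < b → a ≤ c * b → -Real.log b ≤ Real.log c + -Real.log a := by
    intro a b ha hb hab
    have := Real.log_le_log ha hab
    rw [Real.log_mul hc.ne' hb.ne'] at this
    linarith
  cases y with
  | true =>
    rw [logLoss, if_pos rfl, if_pos rfl]
    split_ifs with hp0
    · simp
    · exact_mod_cast aux p q (lt_of_le_of_ne hp.1 (Ne.symm hp0)) hq.1 h₁
  | false =>
    rw [logLoss, if_neg (by simp), if_neg (by simp)]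
    split_ifs with hp1
    · simp
    · exact_mod_cast aux (1 - p) (1 - q) (sub_pos.2 (lt_of_le_of_ne hp.2 hp1))
        (sub_pos.2 hq.2) h₀

theorem neg_log_expertLikelihood_le {X : Type*} {g h : X → ℝ} {c : ℝ}
    (hg : ∀ x, g x ∈ Ioo (0 : ℝ) 1) (hh : ∀ x, h x ∈ Icc (0 : ℝ) 1) (hc : 0 < c)
    (h₁ : ∀ x, h x ≤ c * g x) (h₀ : ∀ x, 1 - h x ≤ c * (1 - g x)) :
    ∀ (xs : List X) (ys : List Bool), xs.length = ys.length →
      ((-Real.log (expertLikelihood g xs ys) : ℝ) : EReal) ≤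
        ((xs.length * Real.log c : ℝ) : EReal) + expertLoss h xs ys
  | [], [], _ => by simp [expertLikelihood, expertLoss]
  | x :: xs, y :: ys, hlen => by
    have ih := neg_log_expertLikelihood_le hg hh hc h₁ h₀ xs ys (by simpa using hlen)
    have hstep := neg_log_le_add_logLoss (hg x) (hh x) hc (h₁ x) (h₀ x) y
    have hpos : 0 < if y then g x else 1 - g x := by
      split_ifs
      exacts [(hg x).1, sub_pos.2 (hg x).2]
    have hL : expertLikelihood g (x :: xs) (y :: ys) =
        (if y then g x else 1 - g x) * expertLikelihood g xs ys := by
      simp [expertLikelihood]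
    have hE : expertLoss h (x :: xs) (y :: ys) = logLoss (h x) y + expertLoss h xs ys := by
      simp [expertLoss]
    rw [hL, hE, Real.log_mul hpos.ne' (expertLikelihood_pos hg xs ys).ne', neg_add, EReal.coe_add]
    refine (add_le_add hstep ih).trans_eq ?_
    rw [add_add_add_comm, ← EReal.coe_add]
    congr 2
    push_cast [List.length_cons]
    ring

/-- The Bayesian mixture of finitely many experts `g i` has regret at most
`log (card ι) + T * log c` against every class each of whose members is dominated, up to the
factor `c`, by one of the `g i`. -/
theorem seqRegret_le_of_finite_domination {X ι : Type*} [Fintype ι] [Nonempty ι]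
    (H : Set (X → ℝ)) (T : ℕ) (g : ι → X → ℝ) {c : ℝ} (hc : 0 < c)
    (hg : ∀ i x, g i x ∈ Ioo (0 : ℝ) 1) (hH : ∀ h ∈ H, ∀ x, h x ∈ Icc (0 : ℝ) 1)
    (hdom : ∀ h ∈ H, ∃ i, ∀ x, h x ≤ c * g i x ∧ 1 - h x ≤ c * (1 - g i x)) :
    seqRegret H T ≤ ((Real.log (Fintype.card ι) + T * Real.log c : ℝ) : EReal) := by
  have hN : (0 : ℝ) < Fintype.card ι := by exact_mod_cast Fintype.card_pos
  have hsum : ∀ xs ys, 0 < ∑ i, expertLikelihood (g i) xs ys := fun xs ys =>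
    Finset.sum_pos (fun i _ => expertLikelihood_pos (hg i) xs ys) Finset.univ_nonempty
  refine seqRegret_le_of_assignment H T _
    (fun xs ys => (∑ i, expertLikelihood (g i) xs ys) / Fintype.card ι)
    (fun xs ys => div_pos (hsum xs ys) hN) ?_ ?_ ?_
  · simp [expertLikelihood, hN.ne']
  · intro xs ys x hlen
    simp only [expertLikelihood_append_singleton _ hlen]
    rw [← add_div, ← Finset.sum_add_distrib]
    congr 1
    refine Finset.sum_congr rfl fun i _ => ?_
    simp only [if_true, Bool.false_eq_true, if_false]
    ring
  · intro xs ys hxs hys h hh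
    obtain ⟨i, hi⟩ := hdom h hh
    have hlik := neg_log_expertLikelihood_le (hg i) (hH h hh) hc (fun x => (hi x).1)
      (fun x => (hi x).2) xs ys (hxs.trans hys.symm)
    have hle : expertLikelihood (g i) xs ys ≤ ∑ j, expertLikelihood (g j) xs ys :=
      Finset.single_le_sum (fun j _ => (expertLikelihood_pos (hg j) xs ys).le) (Finset.mem_univ i)
    have hlog := Real.log_le_log (expertLikelihood_pos (hg i) xs ys) hle
    have hreal : -Real.log ((∑ j, expertLikelihood (g j) xs ys) / Fintype.card ι) ≤
        Real.log (Fintype.card ι) + -Real.log (expertLikelihood (g i) xs ys) := by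
      rw [Real.log_div (hsum xs ys).ne' hN.ne']
      linarith
    refine (EReal.coe_le_coe_iff.2 hreal).trans ?_
    rw [EReal.coe_add, EReal.coe_add, add_assoc, ← hxs]
    exact add_le_add le_rfl hlik

theorem seqRegret_le_horizon {X : Type*} (H : Set (X → ℝ)) (T : ℕ)
    (hH : ∀ h ∈ H, ∀ x, h x ∈ Icc (0 : ℝ) 1) : seqRegret H T ≤ ((T : ℝ) : EReal) := by
  refine (seqRegret_le_of_finite_domination (ι := Unit) H T (fun _ _ => 1 / 2) two_pos
    (fun _ _ => by norm_num) hH fun h hh => ⟨(), fun x => ?_⟩).trans ?_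
  · have := hH h hh x
    constructor <;> linarith [this.1, this.2]
  · rw [EReal.coe_le_coe_iff, Fintype.card_unit, Nat.cast_one, Real.log_one, zero_add]
    refine mul_le_of_le_one_right (Nat.cast_nonneg T) ?_
    linarith [Real.log_two_lt_d9]

/-- Smoothing the members of a finite uniform `α`-net gives regret at most
`log (card ι) + 2 * α * T`. -/
theorem seqRegret_le_of_finite_net {X ι : Type*} [Fintype ι] [Nonempty ι]
    (H : Set (X → ℝ)) (T : ℕ) (g : ι → X → ℝ) {α : ℝ} (hα : 0 < α)
    (hg : ∀ i x, g i x ∈ Icc (0 : ℝ) 1) (hH : ∀ h ∈ H, ∀ x, h x ∈ Icc (0 : ℝ) 1)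
    (hnet : ∀ h ∈ H, ∃ i, ∀ x, |h x - g i x| ≤ α) :
    seqRegret H T ≤ ((Real.log (Fintype.card ι) + 2 * α * T : ℝ) : EReal) := by
  have hc : 0 < 1 + 2 * α := by positivity
  refine (seqRegret_le_of_finite_domination H T (fun i x => (g i x + α) / (1 + 2 * α)) hc
    (fun i x => ⟨?_, ?_⟩) hH fun h hh => ?_).trans ?_
  · exact div_pos (by linarith [(hg i x).1]) hc
  · rw [div_lt_one hc]
    linarith [(hg i x).2]
  · obtain ⟨i, hi⟩ := hnet h hh
    refine ⟨i, fun x => ?_⟩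
    have := abs_le.1 (hi x)
    rw [mul_sub, mul_div_cancel₀ _ hc.ne']
    constructor <;> linarith [this.1, this.2]
  · rw [EReal.coe_le_coe_iff]
    have hlog : Real.log (1 + 2 * α) ≤ 2 * α := by linarith [Real.log_le_sub_one_of_pos hc]
    have := mul_le_mul_of_nonneg_left hlog (Nat.cast_nonneg (α := ℝ) T)
    linarith

theorem lsNorm_eq_norm_toLp {s : ℝ} (hs : 1 ≤ s) {d : ℕ} (w : Fin d → ℝ) :
    lsNorm s w = ‖WithLp.toLp (ENNReal.ofReal s) w‖ := by
  have hs0 : 0 < s := by linarith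
  have hto : (ENNReal.ofReal s).toReal = s := ENNReal.toReal_ofReal hs0.le
  rw [PiLp.norm_eq_sum (by rwa [hto]), hto]
  rfl

/-- Theorem 2: for an `L`-Lipschitz (in the parameter, w.r.t. the `ℓ_s` norm)
parametric class with parameters in the `ℓ_s` ball of radius `R`,
`r^a_T(H_f) ≤ min( d log(2RLT/d + 1) + 2d , T )`. -/
theorem seqRegret_lipschitz_upper (d T : ℕ) (hd : 0 < d) (hT : 0 < T)
    (s R L : ℝ) (hs : 1 ≤ s) (hR : 0 < R) (hL : 0 < L)
    (f : (Fin d → ℝ) → (Fin d → ℝ) → ℝ)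
    (hrange : ∀ w, lsNorm s w ≤ R → ∀ x, f w x ∈ Set.Icc (0:ℝ) 1)
    (hlip : ∀ w₁ w₂, lsNorm s w₁ ≤ R → lsNorm s w₂ ≤ R → ∀ x : Fin d → ℝ,
      |f w₁ x - f w₂ x| ≤ L * lsNorm s (w₁ - w₂)) :
    seqRegret {h : (Fin d → ℝ) → ℝ | ∃ w, lsNorm s w ≤ R ∧ h = f w} T ≤
      ((min ((d : ℝ) * Real.log (2 * R * L * (T : ℝ) / (d : ℝ) + 1) + 2 * (d : ℝ)) ((T : ℝ)) : ℝ) : EReal) := by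
  set H : Set ((Fin d → ℝ) → ℝ) := {h | ∃ w, lsNorm s w ≤ R ∧ h = f w}
  have hH : ∀ h ∈ H, ∀ x, h x ∈ Icc (0 : ℝ) 1 := by
    rintro h ⟨w, hw, rfl⟩
    exact hrange w hw
  have hdR : (0 : ℝ) < d := by exact_mod_cast hd
  have hTR : (0 : ℝ) < T := by exact_mod_cast hT
  have hfact : Fact (1 ≤ ENNReal.ofReal s) := ⟨by simpa using hs⟩
  obtain ⟨N, hNne, hNcard, hNball, hNnet⟩ :=
    exists_finset_net_closedBall (PiLp (ENNReal.ofReal s) fun _ : Fin d => ℝ) hR.le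
      (show 0 < (d : ℝ) / (L * T) by positivity)
  have hdim : Module.finrank ℝ (PiLp (ENNReal.ofReal s) fun _ : Fin d => ℝ) = d := by
    rw [(WithLp.linearEquiv (ENNReal.ofReal s) ℝ (Fin d → ℝ)).finrank_eq, Module.finrank_fin_fun]
  have hball : ∀ c : N, lsNorm s c.1.ofLp ≤ R := fun c => by
    rw [lsNorm_eq_norm_toLp hs]
    exact hNball c c.2
  have : Nonempty N := hNne.to_subtype
  have hbound : seqRegret H T ≤
      ((Real.log (Fintype.card N) + 2 * ((d : ℝ) / T) * T : ℝ) : EReal) := by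
    refine seqRegret_le_of_finite_net H T (fun (c : N) => f c.1.ofLp) (by positivity)
      (fun c => hrange _ (hball c)) hH ?_
    rintro h ⟨w, hw, rfl⟩
    obtain ⟨c, hc, hwc⟩ := hNnet (WithLp.toLp _ w) (by rwa [← lsNorm_eq_norm_toLp hs])
    refine ⟨⟨c, hc⟩, fun x => (hlip w c.ofLp hw (hball ⟨c, hc⟩) x).trans ?_⟩
    rw [lsNorm_eq_norm_toLp hs]
    refine (mul_le_mul_of_nonneg_left hwc hL.le).trans_eq ?_
    field_simp
  rw [hdim] at hNcard
  have hlog : Real.log (Fintype.card N) ≤ d * Real.log (2 * R * L * T / d + 1) := by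
    rw [Fintype.card_coe, ← Real.log_pow]
    refine Real.log_le_log (by exact_mod_cast hNne.card_pos) (hNcard.trans_eq ?_)
    congr 2
    field_simp
  rw [EReal.coe_strictMono.monotone.map_min]
  refine le_min (hbound.trans ?_) (seqRegret_le_horizon H T hH)
  rw [EReal.coe_le_coe_iff, mul_assoc, div_mul_cancel₀ _ hTR.ne']
  linarith
end

section
/- Let s > 0 and let f: ℝ → [0,1] be a function for which there exist c₁, c₂ ∈ (0,1) such that for every r > 0 and all sufficiently large d, the interval [c₁ − c₂·d^{−r}, c₁ + c₂·d^{−r}] is contained in the image f([−d^{−r}, d^{−r}]). For w ∈ B_s^d(1) define h_w(x) = f(⟨w,x⟩), and let H_f = { h_w : w ∈ B_s^d(1) } with feature space X = B_s^d(1). Then there exists a constant C > 0, independent of d and T, such that for all sufficiently large d and all time horizons T divisible by d, r^a_T(H_f) ≥ (d/2)·log( T / d^{(s+2)/s} ) − C·d. -/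
open Set

/-- The sum of `g` over all Boolean lists of length `n`. -/
def boolSum : ℕ → (List Bool → ℝ) → ℝ
  | 0, g => g []
  | n + 1, g => boolSum n (fun b => g (false :: b)) + boolSum n (fun b => g (true :: b))

theorem boolSum_congr {n : ℕ} {g g' : List Bool → ℝ} (h : ∀ b, b.length = n → g b = g' b) :
    boolSum n g = boolSum n g' := by
  induction n generalizing g g' with
  | zero => exact h [] rfl
  | succ n ih =>
    simp only [boolSum]
    rw [ih fun b hb => h (false :: b) (by simp [hb]), ih fun b hb => h (true :: b) (by simp [hb])]

theorem boolSum_pos {n : ℕ} {g : List Bool → ℝ} (h : ∀ b, 0 < g b) : 0 < boolSum n g := by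
  induction n generalizing g with
  | zero => exact h []
  | succ n ih => exact add_pos (ih fun b => h _) (ih fun b => h _)

theorem boolSum_const_mul (n : ℕ) (c : ℝ) (g : List Bool → ℝ) :
    boolSum n (fun b => c * g b) = c * boolSum n g := by
  induction n generalizing g with
  | zero => rfl
  | succ n ih => simp only [boolSum, ih, mul_add]

theorem boolSum_mul_const (n : ℕ) (c : ℝ) (g : List Bool → ℝ) :
    boolSum n (fun b => g b * c) = boolSum n g * c := by
  simp only [mul_comm _ c, boolSum_const_mul]

theorem boolSum_add (m n : ℕ) (g : List Bool → ℝ) :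
    boolSum (m + n) g = boolSum m (fun a => boolSum n (fun b => g (a ++ b))) := by
  induction m generalizing g with
  | zero => simp [boolSum]
  | succ m ih => rw [Nat.succ_add]; simp only [boolSum, ih, List.cons_append]

theorem boolSum_count (n : ℕ) (u : ℕ → ℝ) :
    boolSum n (fun b => u (b.count true)) =
      ∑ i ∈ Finset.range (n + 1), (n.choose i : ℝ) * u i := by
  induction n generalizing u with
  | zero => simp [boolSum]
  | succ n ih =>
    rw [Finset.sum_choose_succ_mul (fun i _ => u i) n, ← ih u, ← ih fun i => u (i + 1)]
    simp [boolSum]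

/-- The product, over `m` consecutive blocks of length `n`, of `u` at the number of `true` labels
in the block. -/
def blockWeight (n : ℕ) (u : ℕ → ℝ) : ℕ → List Bool → ℝ
  | 0, _ => 1
  | m + 1, b => u ((b.take n).count true) * blockWeight n u m (b.drop n)

theorem blockWeight_pos {n : ℕ} {u : ℕ → ℝ} (hu : ∀ k, 0 < u k) (m : ℕ) (b : List Bool) :
    0 < blockWeight n u m b := by
  induction m generalizing b with
  | zero => exact one_pos
  | succ m ih => exact mul_pos (hu _) (ih _)

theorem boolSum_blockWeight (n : ℕ) (u : ℕ → ℝ) (m : ℕ) :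
    boolSum (m * n) (blockWeight n u m) =
      (∑ i ∈ Finset.range (n + 1), (n.choose i : ℝ) * u i) ^ m := by
  induction m with
  | zero => simp [boolSum, blockWeight]
  | succ m ih =>
    rw [Nat.succ_mul, Nat.add_comm, boolSum_add, pow_succ', ← ih, ← boolSum_count,
      ← boolSum_mul_const]
    refine boolSum_congr fun a ha => ?_
    rw [← boolSum_const_mul]
    refine boolSum_congr fun b _ => ?_
    simp [blockWeight, ← ha]

theorem logLoss_ne_bot (p : ℝ) (y : Bool) : logLoss p y ≠ ⊥ := by
  unfold logLoss
  split_ifs <;> simp [-EReal.coe_neg]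

theorem lossSum_append_singleton {ps : List ℝ} {ys : List Bool} (h : ps.length = ys.length)
    (p : ℝ) (y : Bool) : lossSum (ps ++ [p]) (ys ++ [y]) = lossSum ps ys + logLoss p y := by
  simp [lossSum, List.zipWith_append h]

theorem exists_log_add_le_logLoss_add {a₀ a₁ p : ℝ} (h₀ : 0 < a₀) (h₁ : 0 < a₁)
    (hp : p ∈ Icc (0 : ℝ) 1) :
    ∃ y : Bool, ((Real.log (a₀ + a₁) : ℝ) : EReal) ≤
      logLoss p y + ((Real.log (bif y then a₁ else a₀) : ℝ) : EReal) := by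
  have hs : 0 < a₀ + a₁ := add_pos h₀ h₁
  have key : ∀ q a : ℝ, 0 < q → 0 < a → q * (a₀ + a₁) ≤ a →
      Real.log (a₀ + a₁) ≤ -Real.log q + Real.log a := fun q a hq ha h => by
    have := Real.log_le_log (mul_pos hq hs) h
    rw [Real.log_mul hq.ne' hs.ne'] at this
    linarith
  rcases le_total (p * (a₀ + a₁)) a₁ with h | h
  · refine ⟨true, ?_⟩
    rcases eq_or_ne p 0 with rfl | hp0
    · simp [logLoss]
    · simp only [logLoss, hp0, if_true, if_false, cond_true]
      exact_mod_cast key p a₁ (lt_of_le_of_ne hp.1 hp0.symm) h₁ h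
  · refine ⟨false, ?_⟩
    rcases eq_or_ne p 1 with rfl | hp1
    · simp [logLoss]
    · simp only [logLoss, hp1, if_false, cond_false, Bool.false_eq_true]
      exact_mod_cast key (1 - p) a₀ (sub_pos.2 (lt_of_le_of_ne hp.2 hp1)) h₀ (by linarith)

/-- Shtarkov-type lower bound: along a fixed feature sequence `zs`, the remaining game is worth at
least the logarithm of the sum of any certified lower bounds `g` on the maximal likelihoods. -/
theorem lossSum_add_log_boolSum_le_seqRegretAux {X : Type*} (H : Set (X → ℝ)) (zs : List X) :
    ∀ (xs : List X) (ps : List ℝ) (ys : List Bool) (g : List Bool → ℝ),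
      ps.length = ys.length → (∀ b, 0 < g b) →
      (∀ b, b.length = zs.length →
        ⨅ h ∈ H, expertLoss h (xs ++ zs) (ys ++ b) ≤ ((-Real.log (g b) : ℝ) : EReal)) →
      lossSum ps ys + ((Real.log (boolSum zs.length g) : ℝ) : EReal) ≤
        seqRegretAux H zs.length xs ps ys := by
  induction zs with
  | nil =>
    intro xs ps ys g _ _ hg
    simp only [List.length_nil, seqRegretAux, boolSum, pointwiseRegret, sub_eq_add_neg]
    gcongr
    rw [EReal.le_neg]
    simpa using hg [] rfl
  | cons z zs ih =>
    intro xs ps ys g hlen hpos hg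
    simp only [List.length_cons, seqRegretAux]
    refine le_iSup_of_le z (le_iInf fun p => ?_)
    obtain ⟨y, hy⟩ := exists_log_add_le_logLoss_add
      (boolSum_pos (n := zs.length) fun b => hpos (false :: b))
      (boolSum_pos (n := zs.length) fun b => hpos (true :: b)) p.2
    refine le_iSup_of_le y (le_trans ?_ (ih (xs ++ [z]) (ps ++ [(p : ℝ)]) (ys ++ [y])
      (fun b => g (y :: b)) (by simp [hlen]) (fun b => hpos _) fun b hb => ?_))
    · rw [lossSum_append_singleton hlen, add_assoc]
      refine add_le_add le_rfl (hy.trans_eq ?_)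
      cases y <;> rfl
    · simpa using hg (y :: b) (by simp [hb])

theorem sum_zipWith_logLoss_replicate {p : ℝ} (hp : p ∈ Icc (0 : ℝ) 1) (b : List Bool)
    (h : 0 < p ^ b.count true * (1 - p) ^ (b.length - b.count true)) :
    (List.zipWith logLoss (List.replicate b.length p) b).sum =
      ((-Real.log (p ^ b.count true * (1 - p) ^ (b.length - b.count true)) : ℝ) : EReal) := by
  induction b with
  | nil => simp
  | cons y b ih =>
    have hle : b.count true ≤ b.length := List.count_le_length
    cases y
    · have e : (false :: b).length - (false :: b).count true =
          b.length - b.count true + 1 := by simp; omega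
      have e' : (false :: b).count true = b.count true := by simp
      rw [e, e', pow_succ, ← mul_assoc] at h ⊢
      have hq : 0 < 1 - p := (pos_iff_pos_of_mul_pos h).1 (lt_of_le_of_ne
        (mul_nonneg (pow_nonneg hp.1 _) (pow_nonneg (sub_nonneg.2 hp.2) _))
        (left_ne_zero_of_mul h.ne').symm)
      have h' := pos_of_mul_pos_left h hq.le
      simp only [List.length_cons, List.replicate_succ, List.zipWith_cons_cons, List.sum_cons,
        ih h', logLoss]
      rw [Real.log_mul h'.ne' hq.ne', if_neg (by simp), if_neg (by linarith)]
      norm_cast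
      ring
    · have e : (true :: b).length - (true :: b).count true =
          b.length - b.count true := by simp
      have e' : (true :: b).count true = b.count true + 1 := by simp
      rw [e, e', pow_succ, mul_right_comm] at h ⊢
      have hq : 0 < p := (pos_iff_pos_of_mul_pos h).1 (lt_of_le_of_ne
        (mul_nonneg (pow_nonneg hp.1 _) (pow_nonneg (sub_nonneg.2 hp.2) _))
        (left_ne_zero_of_mul h.ne').symm)
      have h' := pos_of_mul_pos_left h hq.le
      simp only [List.length_cons, List.replicate_succ, List.zipWith_cons_cons, List.sum_cons,
        ih h', logLoss]
      rw [Real.log_mul h'.ne' hq.ne', if_pos trivial, if_neg hq.ne']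
      norm_cast
      ring

/-- For a design with a block of `n` repetitions of each coordinate, the labels determine
coordinatewise predictions whose likelihood is the corresponding `blockWeight`. -/
theorem exists_sum_zipWith_logLoss_eq {ι : Type*} [DecidableEq ι] {n : ℕ} {I : Set ℝ} {θ : ℕ → ℝ}
    (hI : I ⊆ Icc 0 1) (hθ : ∀ k, θ k ∈ I)
    (hpos : ∀ k, 0 < θ k ^ k * (1 - θ k) ^ (n - k)) (is : List ι) (his : is.Nodup) :
    ∀ b : List Bool, b.length = is.length * n → ∃ q : ι → ℝ, (∀ i, q i ∈ I) ∧
      (List.zipWith logLoss (is.flatMap fun i => List.replicate n (q i)) b).sum =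
        ((-Real.log (blockWeight n (fun k => θ k ^ k * (1 - θ k) ^ (n - k)) is.length b) : ℝ) :
          EReal) := by
  induction is with
  | nil => exact fun b _ => ⟨fun _ => θ 0, fun _ => hθ 0, by simp [blockWeight]⟩
  | cons i is ih =>
    intro b hb
    rw [List.length_cons, Nat.succ_mul] at hb
    obtain ⟨q, hq, hsum⟩ := ih (List.nodup_cons.1 his).2 (b.drop n) (by simp [hb])
    have hlen : (b.take n).length = n := by simp [hb]
    set k := (b.take n).count true with hk
    refine ⟨Function.update q i (θ k), fun j => ?_, ?_⟩
    · rcases eq_or_ne j i with rfl | hj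
      · simpa using hθ k
      · simpa [hj] using hq j
    · have hc : (is.flatMap fun j => List.replicate n (Function.update q i (θ k) j)) =
          is.flatMap fun j => List.replicate n (q j) :=
        List.flatMap_congr fun j hj => by
          rw [Function.update_of_ne (ne_of_mem_of_not_mem hj (List.nodup_cons.1 his).1)]
      have hblock := sum_zipWith_logLoss_replicate (hI (hθ k)) (b.take n)
        (by rw [hlen]; exact hpos k)
      rw [hlen, ← hk] at hblock
      rw [List.flatMap_cons, hc, Function.update_self, ← List.take_append_drop n b,
        List.zipWith_append (by simp [hb]), List.sum_append, hsum, hblock,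
        List.take_append_drop, List.length_cons, blockWeight, ← hk,
        Real.log_mul (hpos k).ne' (blockWeight_pos hpos _ _).ne']
      norm_cast
      ring

theorem factorial_le_mul_sqrt {n : ℕ} (hn : n ≠ 0) :
    (n.factorial : ℝ) ≤ Real.exp 1 * √n * (n / Real.exp 1) ^ n := by
  obtain ⟨m, rfl⟩ := Nat.exists_eq_succ_of_ne_zero hn
  have h := Stirling.stirlingSeq'_antitone (Nat.zero_le m)
  simp only [Function.comp, Nat.succ_eq_add_one, zero_add, Stirling.stirlingSeq_one] at h
  rw [Stirling.stirlingSeq, div_le_iff₀ (by positivity)] at h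
  refine h.trans_eq ?_
  rw [Real.sqrt_mul (by norm_num)]
  field_simp

theorem inv_two_mul_sqrt_le_choose_mul {n k : ℕ} (hn : 0 < n) (hk : k ≤ n) :
    1 / (2 * √n) ≤ (n.choose k : ℝ) * ((k / n : ℝ) ^ k * (1 - k / n : ℝ) ^ (n - k)) := by
  have hn1 : (1 : ℝ) ≤ n := by exact_mod_cast hn
  have hsqrt : 1 ≤ √(n : ℝ) := Real.one_le_sqrt.2 hn1
  have hle1 : 1 / (2 * √(n : ℝ)) ≤ 1 := by
    rw [div_le_one (by positivity)]; linarith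
  rcases Nat.eq_zero_or_pos k with rfl | hk0
  · simpa using hle1
  rcases hk.eq_or_lt with rfl | hkn
  · simpa [div_self (by positivity : (k : ℝ) ≠ 0)] using hle1
  obtain ⟨m, rfl⟩ := Nat.exists_eq_add_of_le hk
  have hm0 : 0 < m := by omega
  have hkr : (0 : ℝ) < k := by exact_mod_cast hk0
  have hmr : (0 : ℝ) < m := by exact_mod_cast hm0
  have h1 := factorial_le_mul_sqrt hk0.ne'
  have h2 := factorial_le_mul_sqrt hm0.ne'
  have h3 := Stirling.le_factorial_stirling (k + m)
  have e1 : (1 - k / ((k + m : ℕ) : ℝ)) = m / ((k + m : ℕ) : ℝ) := by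
    push_cast; field_simp; ring
  rw [e1, Nat.add_sub_cancel_left, Nat.choose_eq_factorial_div_factorial hk,
    Nat.add_sub_cancel_left, Nat.cast_div (Nat.factorial_mul_factorial_dvd_factorial_add k m)
      (by positivity)]
  set N : ℝ := ((k + m : ℕ) : ℝ) with hN
  have hNe : N = k + m := by simp [hN]
  have hN0 : 0 < N := by positivity
  have hpi : 2 ≤ √(2 * Real.pi) := by
    apply Real.le_sqrt_of_sq_le
    nlinarith [Real.pi_gt_three]
  have hexp : Real.exp 1 ^ 2 ≤ 8 := by
    nlinarith [Real.exp_one_lt_d9, Real.exp_pos 1]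
  have hgm : √(k : ℝ) * √m ≤ N / 2 := by
    rw [← Real.sqrt_mul hkr.le]
    apply Real.sqrt_le_iff.2
    constructor
    · positivity
    · rw [hNe]; nlinarith [sq_nonneg ((k : ℝ) - m)]
  have hden : ((k.factorial * m.factorial : ℕ) : ℝ) ≤
      4 * N * ((k / Real.exp 1) ^ k * (m / Real.exp 1) ^ m) := by
    push_cast
    calc (k.factorial : ℝ) * m.factorial
        ≤ (Real.exp 1 * √k * (k / Real.exp 1) ^ k) * (Real.exp 1 * √m * (m / Real.exp 1) ^ m) := by
          gcongr
      _ = Real.exp 1 ^ 2 * (√k * √m) * ((k / Real.exp 1) ^ k * (m / Real.exp 1) ^ m) := by ring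
      _ ≤ 8 * (N / 2) * ((k / Real.exp 1) ^ k * (m / Real.exp 1) ^ m) := by gcongr
      _ = _ := by ring
  have hnum : 2 * √N * (N / Real.exp 1) ^ (k + m) ≤ ((k + m).factorial : ℝ) := by
    refine le_trans ?_ h3
    rw [Real.sqrt_mul (by positivity)]
    gcongr
  have hmain : 1 / (2 * √N) = 2 * √N * (N / Real.exp 1) ^ (k + m) /
      (4 * N * ((k / Real.exp 1) ^ k * (m / Real.exp 1) ^ m)) *
        ((k / N) ^ k * (m / N) ^ m) := by
    have hsq : √N ^ 2 = N := Real.sq_sqrt hN0.le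
    have hs0 : 0 < √N := Real.sqrt_pos.2 hN0
    have he := Real.exp_pos 1
    rw [div_pow, div_pow, div_pow, div_pow, div_pow, pow_add, pow_add]
    field_simp
    linear_combination (-4) * hsq
  rw [hmain]
  gcongr

/-- A Bernoulli class whose parameter interval has half-width `δ` has Shtarkov sum at least of order
`δ √n`. -/
theorem exists_le_sum_choose_mul {n : ℕ} (hn : 0 < n) {c ε : ℝ} (hc : c ∈ Ioo (0 : ℝ) 1)
    (hε : 0 < ε) (hI : Icc (c - ε) (c + ε) ⊆ Icc 0 1) :
    ∃ θ : ℕ → ℝ, (∀ k, θ k ∈ Icc (c - ε) (c + ε)) ∧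
      (∀ k, 0 < θ k ^ k * (1 - θ k) ^ (n - k)) ∧
      ε / 2 * √n ≤ ∑ k ∈ Finset.range (n + 1),
        (n.choose k : ℝ) * (θ k ^ k * (1 - θ k) ^ (n - k)) := by
  have hn1 : (1 : ℝ) ≤ n := by exact_mod_cast hn
  have hn0 : (0 : ℝ) < n := by positivity
  have hsq : √(n : ℝ) * √n = n := Real.mul_self_sqrt hn0.le
  have hsqrt : 1 ≤ √(n : ℝ) := Real.one_le_sqrt.2 hn1
  have hcI : c ∈ Icc (c - ε) (c + ε) := ⟨by linarith, by linarith⟩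
  have hcpos : ∀ i j : ℕ, 0 < c ^ i * (1 - c) ^ j := fun i j =>
    mul_pos (pow_pos hc.1 _) (pow_pos (sub_pos.2 hc.2) _)
  rcases le_total 1 (ε * n) with h | h
  · have hlo : 0 ≤ c - ε := (hI (left_mem_Icc.2 (by linarith))).1
    have hhi : c + ε ≤ 1 := (hI (right_mem_Icc.2 (by linarith))).2
    set K : Finset ℕ := Finset.Icc ⌈(c - ε) * n⌉₊ ⌊(c + ε) * n⌋₊ with hK
    have hmem : ∀ k ∈ K, (k / n : ℝ) ∈ Icc (c - ε) (c + ε) := fun k hk => by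
      rw [hK, Finset.mem_Icc, Nat.ceil_le, Nat.le_floor_iff (by nlinarith)] at hk
      exact ⟨(le_div_iff₀ hn0).2 hk.1, (div_le_iff₀ hn0).2 hk.2⟩
    have hkn : ∀ k ∈ K, k ≤ n := fun k hk => by
      have := (hI (hmem k hk)).2
      rw [div_le_one hn0] at this
      exact_mod_cast this
    have hbound : ∀ k ∈ K, 1 / (2 * √(n : ℝ)) ≤
        (n.choose k : ℝ) * ((k / n : ℝ) ^ k * (1 - k / n : ℝ) ^ (n - k)) := fun k hk =>
      inv_two_mul_sqrt_le_choose_mul hn (hkn k hk)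
    have hθpos : ∀ k, 0 < (if k ∈ K then (k / n : ℝ) else c) ^ k *
        (1 - (if k ∈ K then (k / n : ℝ) else c)) ^ (n - k) := fun k => by
      split_ifs with hk
      · exact pos_of_mul_pos_right (lt_of_lt_of_le (by positivity) (hbound k hk)) (by positivity)
      · exact hcpos _ _
    refine ⟨fun k => if k ∈ K then k / n else c, fun k => ?_, hθpos, ?_⟩
    · dsimp only
      split_ifs with hk
      exacts [hmem k hk, hcI]
    · have hcard : ε * n ≤ (K.card : ℝ) := by
        have h1 := Nat.lt_floor_add_one ((c + ε) * (n : ℝ))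
        have h2 := Nat.ceil_lt_add_one (mul_nonneg hlo hn0.le)
        rw [hK, Nat.card_Icc]
        have h3 : ((⌊(c + ε) * n⌋₊ + 1 : ℕ) : ℝ) - (⌈(c - ε) * n⌉₊ : ℕ) ≤
            ((⌊(c + ε) * n⌋₊ + 1 - ⌈(c - ε) * n⌉₊ : ℕ) : ℝ) := by
          rw [sub_le_iff_le_add]
          exact_mod_cast le_tsub_add
        push_cast at h3 ⊢
        nlinarith
      calc ε / 2 * √n = ε * n * (1 / (2 * √n)) := by
            field_simp
            linear_combination hsq
        _ ≤ K.card * (1 / (2 * √n)) := by gcongr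
        _ = ∑ k ∈ K, 1 / (2 * √(n : ℝ)) := by rw [Finset.sum_const, nsmul_eq_mul]
        _ ≤ ∑ k ∈ K, (n.choose k : ℝ) * ((if k ∈ K then (k / n : ℝ) else c) ^ k *
              (1 - (if k ∈ K then (k / n : ℝ) else c)) ^ (n - k)) :=
            Finset.sum_le_sum fun k hk => by simpa only [if_pos hk] using hbound k hk
        _ ≤ _ := Finset.sum_le_sum_of_subset_of_nonneg
            (fun k hk => Finset.mem_range.2 (Nat.lt_succ_of_le (hkn k hk)))
            fun k _ _ => mul_nonneg (by positivity) (hθpos k).le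
  · refine ⟨fun _ => c, fun _ => hcI, fun _ => hcpos _ _, ?_⟩
    have hsum := add_pow c (1 - c) n
    rw [add_sub_cancel, one_pow] at hsum
    simp only [mul_comm (n.choose _ : ℝ)]
    rw [← hsum]
    nlinarith

theorem lsNorm_single {s : ℝ} (hs : 0 < s) {d : ℕ} (i : Fin d) :
    lsNorm s (Pi.single i (1 : ℝ)) = 1 := by
  have : ∀ j, |(Pi.single i (1 : ℝ) : Fin d → ℝ) j| ^ s = if j = i then 1 else 0 := fun j => by
    rcases eq_or_ne j i with rfl | h
    · simp
    · simp [h, Real.zero_rpow hs.ne']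
  simp [lsNorm, this]

theorem lsNorm_le_one {s : ℝ} (hs : 0 < s) {d : ℕ} (hd : 0 < d) {w : Fin d → ℝ}
    (hw : ∀ i, |w i| ≤ (d : ℝ) ^ (-(1 / s))) : lsNorm s w ≤ 1 := by
  have hd0 : (0 : ℝ) < d := by exact_mod_cast hd
  refine Real.rpow_le_one (by positivity) ?_ (by positivity)
  calc ∑ i, |w i| ^ s ≤ ∑ _i : Fin d, (d : ℝ)⁻¹ := Finset.sum_le_sum fun i _ => by
        refine (Real.rpow_le_rpow (abs_nonneg _) (hw i) hs.le).trans_eq ?_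
        rw [← Real.rpow_mul hd0.le, neg_mul, one_div_mul_cancel hs.ne', Real.rpow_neg_one]
    _ = 1 := by simp [hd0.ne']

/-- Theorem 5: lower bound for generalized linear classes
`H_f = { x ↦ f(⟨w,x⟩) : ‖w‖_s ≤ 1 }` over the unit `ℓ_s` ball:
`r^a_T(H_f) ≥ (d/2) log( T / d^{(s+2)/s} ) - C d` for some constant `C`
independent of `d` and `T`, for all sufficiently large `d` and all
time horizons `T` divisible by `d`. -/
theorem seqRegret_glm_lower (s : ℝ) (hs : 0 < s)
    (f : ℝ → ℝ) (hf : ∀ z : ℝ, f z ∈ Set.Icc (0:ℝ) 1)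
    (c₁ c₂ : ℝ) (hc₁ : c₁ ∈ Set.Ioo (0:ℝ) 1) (hc₂ : c₂ ∈ Set.Ioo (0:ℝ) 1)
    (himg : ∀ r : ℝ, 0 < r → ∃ D : ℕ, ∀ d : ℕ, D ≤ d →
      Set.Icc (c₁ - c₂ * (d : ℝ) ^ (-r)) (c₁ + c₂ * (d : ℝ) ^ (-r)) ⊆
        f '' Set.Icc (-((d : ℝ) ^ (-r))) ((d : ℝ) ^ (-r))) :
    ∃ C : ℝ, 0 < C ∧ ∃ D : ℕ, ∀ d : ℕ, D ≤ d → ∀ T : ℕ, 0 < T → d ∣ T →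
      ((((d : ℝ) / 2) * Real.log ((T : ℝ) / (d : ℝ) ^ ((s + 2) / s)) - C * (d : ℝ) : ℝ) : EReal) ≤
        seqRegret {h : {x : Fin d → ℝ // lsNorm s x ≤ 1} → ℝ |
          ∃ w : Fin d → ℝ, lsNorm s w ≤ 1 ∧ h = fun x => f (∑ i, w i * x.1 i)} T := by
  set c := c₂ / 2 with hcdef
  have hc0 : 0 < c := half_pos hc₂.1
  have hc1 : c < 1 := by linarith [hc₂.2]
  obtain ⟨D, hD⟩ := himg (1 / s) (by positivity)
  refine ⟨-Real.log c, neg_pos.2 (Real.log_neg hc0 hc1), D + 1, ?_⟩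
  rintro d hd T hT ⟨n, rfl⟩
  have hdpos : 0 < d := by omega
  have hn : 0 < n := Nat.pos_of_mul_pos_left hT
  have hd0 : (0 : ℝ) < d := by exact_mod_cast hdpos
  have hn0 : (0 : ℝ) < n := by exact_mod_cast hn
  set δ := (d : ℝ) ^ (-(1 / s)) with hδ
  have hδ0 : 0 < δ := by positivity
  have hsub := hD d (by omega)
  have hI : Icc (c₁ - c₂ * δ) (c₁ + c₂ * δ) ⊆ Icc 0 1 := fun z hz => by
    obtain ⟨v, -, rfl⟩ := hsub hz
    exact hf v
  obtain ⟨θ, hθ, hpos, hsum⟩ := exists_le_sum_choose_mul hn hc₁ (mul_pos hc₂.1 hδ0) hI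
  set u : ℕ → ℝ := fun k => θ k ^ k * (1 - θ k) ^ (n - k) with hu
  set S := ∑ k ∈ Finset.range (n + 1), (n.choose k : ℝ) * (θ k ^ k * (1 - θ k) ^ (n - k)) with hS
  set H : Set ({x : Fin d → ℝ // lsNorm s x ≤ 1} → ℝ) := {h |
    ∃ w : Fin d → ℝ, lsNorm s w ≤ 1 ∧ h = fun x => f (∑ i, w i * x.1 i)} with hH
  let e : Fin d → {x : Fin d → ℝ // lsNorm s x ≤ 1} := fun i =>
    ⟨Pi.single i 1, (lsNorm_single hs i).le⟩
  set zs := (List.finRange d).flatMap fun i => List.replicate n (e i) with hzs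
  have hzlen : zs.length = d * n := by simp [hzs, List.length_flatMap]
  have hgame := lossSum_add_log_boolSum_le_seqRegretAux H zs [] [] [] (blockWeight n u d) rfl
    (blockWeight_pos hpos d) fun b hb => by
      obtain ⟨q, hq, hqsum⟩ := exists_sum_zipWith_logLoss_eq hI hθ hpos (List.finRange d)
        (List.nodup_finRange d) b (by rw [hb, hzlen, List.length_finRange])
      choose w hw hwq using fun i => hsub (hq i)
      rw [List.length_finRange] at hqsum
      rw [← hqsum]
      refine iInf₂_le_of_le (fun x => f (∑ i, w i * x.1 i))
        ⟨w, lsNorm_le_one hs hdpos fun i => abs_le.2 (hw i), rfl⟩ (le_of_eq ?_)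
      have hmap : (List.finRange d).flatMap (fun i => List.replicate n (q i)) =
          zs.map fun x => f (∑ i, w i * x.1 i) := by
        rw [hzs, List.map_flatMap]
        refine List.flatMap_congr fun i _ => ?_
        simp [e, hwq, Pi.single_apply]
      rw [hmap, List.zipWith_map_left]
      rfl
  rw [hzlen, boolSum_blockWeight] at hgame
  refine le_trans ?_ hgame
  simp only [lossSum, List.zipWith_nil_left, List.sum_nil, zero_add]
  rw [EReal.coe_le_coe_iff, Real.log_pow]
  have hratio : ((d * n : ℕ) : ℝ) / (d : ℝ) ^ ((s + 2) / s) = (δ * √n) ^ 2 := by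
    rw [mul_pow, Real.sq_sqrt hn0.le, hδ, ← Real.rpow_natCast, ← Real.rpow_mul hd0.le,
      show (s + 2) / s = 1 - -(1 / s) * (2 : ℕ) by push_cast; field_simp; ring,
      Real.rpow_sub hd0, Real.rpow_one]
    push_cast
    field_simp
  have hlog : Real.log c + Real.log (δ * √n) ≤ Real.log S := by
    rw [← Real.log_mul hc0.ne' (by positivity)]
    refine Real.log_le_log (by positivity) (le_trans (le_of_eq ?_) hsum)
    rw [hcdef]; ring
  rw [hratio, Real.log_pow]
  push_cast
  nlinarith
end

section
/- Let H be a class of functions X → [0,1], let T be a time horizon, and let α ∈ (0,1). If the sequential (α/3)-fat shattering number d(α/3) of H is finite, then there exists a global sequential α-covering set G_α of H at scale T with |G_α| ≤ Σ_{t=0}^{d(α/3)} C(T,t)·⌈3/(2α)⌉^t ≤ ⌈3T/(2α)⌉^{d(α/3)+1}, where C(T,t) is the binomial coefficient. -/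
open Set

/-- `H` `α`-fat shatters the binary tree `τ` of depth `n`: there is a witness tree
`s` such that for every path `ε ∈ {0,1}^n` some `h ∈ H` goes below `s - α` when
`ε_t = 0` and above `s + α` when `ε_t = 1`, along the path. -/
def FatShatters {X : Type*} (H : Set (X → ℝ)) (α : ℝ) (n : ℕ)
    (τ : List Bool → X) : Prop :=
  ∃ s : List Bool → ℝ, ∀ ε : Fin n → Bool, ∃ h ∈ H, ∀ t : Fin n,
    (ε t = false →
      h (τ ((List.ofFn ε).take t.1)) ≤ s ((List.ofFn ε).take t.1) - α) ∧
    (ε t = true →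
      s ((List.ofFn ε).take t.1) + α ≤ h (τ ((List.ofFn ε).take t.1)))

/-- Recursive form of fat shattering at depth `n`. -/
def RecFatShatters {X : Type*} (a : ℝ) : ℕ → Set (X → ℝ) → Prop
  | 0, V => V.Nonempty
  | n + 1, V => ∃ (x : X) (s : ℝ), RecFatShatters a n {h ∈ V | h x ≤ s - a} ∧
      RecFatShatters a n {h ∈ V | s + a ≤ h x}

/-- `V` has a sequential `α`-cover at scale `T` indexed by `Fin n`. -/
def HasSeqCover {X : Type*} (α : ℝ) (T n : ℕ) (V : Set (X → ℝ)) : Prop :=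
  ∃ g : Fin n → List X → ℝ, (∀ i l, g i l ∈ Set.Icc (0 : ℝ) 1) ∧
    ∀ l : List X, l.length = T → ∀ h ∈ V, ∃ i, ∀ (t : ℕ) (ht : t < l.length),
      |h l[t] - g i (l.take (t + 1))| ≤ α

theorem RecFatShatters.mono {X : Type*} {a : ℝ} {n : ℕ} {V W : Set (X → ℝ)} (hVW : V ⊆ W)
    (hV : RecFatShatters a n V) : RecFatShatters a n W := by
  induction n generalizing V W with
  | zero => exact Set.Nonempty.mono hVW hV
  | succ n ih =>
    obtain ⟨x, s, h₀, h₁⟩ := hV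
    exact ⟨x, s, ih (fun h hh => ⟨hVW hh.1, hh.2⟩) h₀, ih (fun h hh => ⟨hVW hh.1, hh.2⟩) h₁⟩

theorem RecFatShatters.exists_fatShatters {X : Type*} [Nonempty X] {a : ℝ} {n : ℕ}
    {V : Set (X → ℝ)} (hV : RecFatShatters a n V) : ∃ τ : List Bool → X, FatShatters V a n τ := by
  induction n generalizing V with
  | zero =>
    obtain ⟨h, hh⟩ := hV
    exact ⟨fun _ => Classical.arbitrary X, fun _ => 0, fun _ => ⟨h, hh, fun t => t.elim0⟩⟩
  | succ n ih =>
    obtain ⟨x, s, h₀, h₁⟩ := hV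
    obtain ⟨τ₀, s₀, H₀⟩ := ih h₀
    obtain ⟨τ₁, s₁, H₁⟩ := ih h₁
    let τ : List Bool → X
      | [] => x
      | false :: l => τ₀ l
      | true :: l => τ₁ l
    let σ : List Bool → ℝ
      | [] => s
      | false :: l => s₀ l
      | true :: l => s₁ l
    refine ⟨τ, σ, fun ε => ?_⟩
    cases hε : ε 0 with
    | false =>
      obtain ⟨h, hh, H⟩ := H₀ (fun i => ε i.succ)
      refine ⟨h, hh.1, fun t => ?_⟩
      refine Fin.cases ?_ (fun i => ?_) t
      · simpa [hε, τ, σ] using hh.2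
      · simpa [List.ofFn_succ, hε, τ, σ] using H i
    | true =>
      obtain ⟨h, hh, H⟩ := H₁ (fun i => ε i.succ)
      refine ⟨h, hh.1, fun t => ?_⟩
      refine Fin.cases ?_ (fun i => ?_) t
      · simpa [hε, τ, σ] using hh.2
      · simpa [List.ofFn_succ, hε, τ, σ] using H i

theorem HasSeqCover.zero {X : Type*} {α : ℝ} (V : Set (X → ℝ)) : HasSeqCover α 0 1 V := by
  refine ⟨fun _ _ => 0, fun _ _ => by simp, fun l hl h _ => ⟨0, fun t ht => ?_⟩⟩
  omega

theorem HasSeqCover.succ {X : Type*} {α : ℝ} {T n₀ n₁ N : ℕ} {V : Set (X → ℝ)}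
    (W : X → Fin N → Set (X → ℝ)) (p : X → ℝ) (c : Fin N → ℝ)
    (hp : ∀ x, p x ∈ Set.Icc (0 : ℝ) 1) (hc : ∀ k, c k ∈ Set.Icc (0 : ℝ) 1)
    (hV : HasSeqCover α T n₀ V)
    (hW : ∀ x, ∀ h ∈ V, |h x - p x| ≤ α ∨
      ∃ k, HasSeqCover α T n₁ (W x k) ∧ h ∈ W x k ∧ |h x - c k| ≤ α) :
    HasSeqCover α (T + 1) (n₀ + N * n₁) V := by
  classical
  obtain ⟨g₀, hg₀, hcov₀⟩ := hV
  have key : ∀ x k, ∃ g : Fin n₁ → List X → ℝ, (∀ i l, g i l ∈ Set.Icc (0 : ℝ) 1) ∧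
      (HasSeqCover α T n₁ (W x k) → ∀ l : List X, l.length = T → ∀ h ∈ W x k, ∃ i,
        ∀ (t : ℕ) (ht : t < l.length), |h l[t] - g i (l.take (t + 1))| ≤ α) := by
    intro x k
    by_cases hcov : HasSeqCover α T n₁ (W x k)
    · obtain ⟨g, hg, hg'⟩ := hcov
      exact ⟨g, hg, fun _ => hg'⟩
    · exact ⟨fun _ _ => 0, fun _ _ => by simp, fun h => absurd h hcov⟩
  choose g₁ hg₁ hcov₁ using key
  let e : Fin (n₀ + N * n₁) ≃ Fin n₀ ⊕ Fin N × Fin n₁ :=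
    (Fintype.equivFinOfCardEq (by simp)).symm
  let G : Fin n₀ ⊕ Fin N × Fin n₁ → List X → ℝ
    | _, [] => 0
    | .inl _, [x] => p x
    | .inl i, _ :: y :: l => g₀ i (y :: l)
    | .inr (k, _), [_] => c k
    | .inr (k, i), x :: y :: l => g₁ x k i (y :: l)
  refine ⟨fun i => G (e i), fun i l => ?_, ?_⟩
  · change G (e i) l ∈ _
    generalize e i = j
    rcases j with i | ⟨k, i⟩ <;> rcases l with _ | ⟨x, _ | ⟨y, l⟩⟩
    · simp [G]
    · exact hp x
    · exact hg₀ _ _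
    · simp [G]
    · exact hc k
    · exact hg₁ _ _ _ _
  rintro (_ | ⟨x, l⟩) hl h hh
  · simp at hl
  have hl' : l.length = T := by simpa using hl
  rcases hW x h hh with hx | ⟨k, hk, hhk, hx⟩
  · obtain ⟨i, hi⟩ := hcov₀ l hl' h hh
    refine ⟨e.symm (.inl i), fun t ht => ?_⟩
    rcases t with _ | t
    · simpa [G] using hx
    · have ht' : t < l.length := by simpa using ht
      specialize hi t ht'
      rcases l with _ | ⟨y, l⟩
      · simp at ht'
      · simpa [G] using hi
  · obtain ⟨i, hi⟩ := hcov₁ x k hk l hl' h hhk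
    refine ⟨e.symm (.inr (k, i)), fun t ht => ?_⟩
    rcases t with _ | t
    · simpa [G] using hx
    · have ht' : t < l.length := by simpa using ht
      specialize hi t ht'
      rcases l with _ | ⟨y, l⟩
      · simp at ht'
      · simpa [G] using hi

/-- The functions of `V` whose value at `x` lies in the `k`-th grid cell of width `2 * a`. -/
def gridCell {X : Type*} (a : ℝ) (V : Set (X → ℝ)) (x : X) (k : ℕ) : Set (X → ℝ) :=
  {h ∈ V | k * (2 * a) ≤ h x ∧ h x ≤ (k + 1) * (2 * a)}

theorem le_succ_of_recFatShatters_gridCell {X : Type*} {a : ℝ} (ha : 0 < a) {m : ℕ}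
    {V : Set (X → ℝ)} (hV : ¬ RecFatShatters a (m + 1) V) {x : X} {k l : ℕ}
    (hk : RecFatShatters a m (gridCell a V x k)) (hl : RecFatShatters a m (gridCell a V x l)) :
    l ≤ k + 1 := by
  by_contra! hlt
  have hkl : (k : ℝ) + 2 ≤ l := by exact_mod_cast hlt
  refine hV ⟨x, (k + 1) * (2 * a) + a, hk.mono fun h hh => ⟨hh.1, ?_⟩,
    hl.mono fun h hh => ⟨hh.1, ?_⟩⟩
  · linarith [hh.2.2]
  · nlinarith [hh.2.1]

theorem exists_prediction {X : Type*} {a : ℝ} (ha : 0 < a) {m : ℕ} {V : Set (X → ℝ)}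
    (hV01 : ∀ h ∈ V, ∀ x, h x ∈ Set.Icc (0 : ℝ) 1) (hV : ¬ RecFatShatters a (m + 1) V) (x : X) :
    ∃ p ∈ Set.Icc (0 : ℝ) 1, ∀ k, RecFatShatters a m (gridCell a V x k) →
      ∀ h ∈ gridCell a V x k, |h x - p| ≤ 3 * a := by
  classical
  by_cases hex : ∃ k, RecFatShatters a m (gridCell a V x k)
  · have hk₀ := Nat.find_spec hex
    set k₀ := Nat.find hex with hk₀_def
    refine ⟨min 1 ((k₀ + 1) * (2 * a)), ⟨by positivity, min_le_left _ _⟩, fun k hk h hh => ?_⟩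
    have h₁ : (k₀ : ℝ) ≤ k := by exact_mod_cast Nat.find_min' hex hk
    have h₂ : (k : ℝ) ≤ k₀ + 1 := by
      exact_mod_cast le_succ_of_recFatShatters_gridCell ha hV hk₀ hk
    have h₃ := hV01 h hh.1 x
    have h₄ := hh.2.1
    have h₅ := hh.2.2
    have h₆ : k₀ * (2 * a) ≤ k * (2 * a) := by gcongr
    have h₇ : k * (2 * a) ≤ (k₀ + 1) * (2 * a) := by gcongr
    rw [abs_le]
    rcases min_cases (1 : ℝ) ((k₀ + 1) * (2 * a)) with h | h <;> rw [h.1] <;>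
      constructor <;> linarith [h₃.1, h₃.2, h.2]
  · exact ⟨0, by simp, fun k hk => absurd ⟨k, hk⟩ hex⟩

theorem exists_mem_gridCell {X : Type*} {a : ℝ} (ha : 0 < a) {N : ℕ} (hN : 1 ≤ N * (2 * a))
    {V : Set (X → ℝ)} (hV01 : ∀ h ∈ V, ∀ x, h x ∈ Set.Icc (0 : ℝ) 1) {h : X → ℝ} (hh : h ∈ V)
    (x : X) : ∃ k : Fin N, h ∈ gridCell a V x k := by
  obtain ⟨h₀, h₁⟩ := hV01 h hh x
  have hN0 : N ≠ 0 := by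
    rintro rfl
    norm_num at hN
  by_cases hlt : ⌊h x / (2 * a)⌋₊ < N
  · refine ⟨⟨_, hlt⟩, hh, ?_, ?_⟩
    · rw [← le_div_iff₀ (by positivity)]
      exact Nat.floor_le (by positivity)
    · rw [← div_le_iff₀ (by positivity)]
      exact (Nat.lt_floor_add_one _).le
  · have h₂ : (N : ℝ) * (2 * a) ≤ h x := by
      rw [← le_div_iff₀ (by positivity)]
      exact (Nat.le_floor_iff (by positivity)).1 (not_lt.1 hlt)
    refine ⟨⟨N - 1, by omega⟩, hh, ?_, ?_⟩ <;>
      push_cast [Nat.cast_sub (Nat.one_le_iff_ne_zero.2 hN0)] <;> linarith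

theorem sum_choose_succ_mul_pow (T m N : ℕ) :
    ∑ t ∈ Finset.range (m + 2), (T + 1).choose t * N ^ t =
      ∑ t ∈ Finset.range (m + 2), T.choose t * N ^ t +
        N * ∑ t ∈ Finset.range (m + 1), T.choose t * N ^ t := by
  rw [Finset.sum_range_succ', Finset.sum_range_succ' (fun t => T.choose t * N ^ t),
    Finset.mul_sum, add_right_comm, ← Finset.sum_add_distrib]
  simp only [Nat.choose_succ_succ, Nat.choose_zero_right]
  congr 1
  exact Finset.sum_congr rfl fun t _ => by ring

theorem hasSeqCover_of_not_recFatShatters {X : Type*} {a : ℝ} (ha : 0 < a) {N : ℕ}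
    (hN : 1 ≤ N * (2 * a)) (T m : ℕ) {V : Set (X → ℝ)}
    (hV01 : ∀ h ∈ V, ∀ x, h x ∈ Set.Icc (0 : ℝ) 1) (hV : ¬ RecFatShatters a (m + 1) V) :
    HasSeqCover (3 * a) T (∑ t ∈ Finset.range (m + 1), T.choose t * N ^ t) V := by
  induction T generalizing m V with
  | zero =>
    have : ∑ t ∈ Finset.range (m + 1), (0 : ℕ).choose t * N ^ t = 1 := by
      simp [Finset.sum_range_succ']
    rw [this]
    exact HasSeqCover.zero V
  | succ T ih =>
    choose p hp hpred using exists_prediction ha hV01 hV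
    have hc : ∀ k : Fin N, min 1 ((k : ℝ) * (2 * a)) ∈ Set.Icc (0 : ℝ) 1 :=
      fun k => ⟨by positivity, min_le_left _ _⟩
    have hcell : ∀ (x : X) (k : Fin N), ∀ h ∈ gridCell a V x k,
        |h x - min 1 ((k : ℝ) * (2 * a))| ≤ 3 * a := by
      intro x k h hh
      rw [min_eq_right (hh.2.1.trans (hV01 h hh.1 x).2), abs_le]
      constructor <;> linarith [hh.2.1, hh.2.2]
    rcases m with _ | m
    · have hcov := HasSeqCover.succ (n₁ := 0) (fun x (k : Fin N) => gridCell a V x k) p _ hp hc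
        (ih 0 hV01 hV) fun x h hh => by
          obtain ⟨k, hk⟩ := exists_mem_gridCell ha hN hV01 hh x
          exact .inl (hpred x k ⟨h, hk⟩ h hk)
      simpa using hcov
    · rw [sum_choose_succ_mul_pow]
      refine HasSeqCover.succ (fun x (k : Fin N) => gridCell a V x k) p _ hp hc
        (ih (m + 1) hV01 hV) fun x h hh => ?_
      obtain ⟨k, hk⟩ := exists_mem_gridCell ha hN hV01 hh x
      by_cases hs : RecFatShatters a (m + 1) (gridCell a V x k)
      · exact .inl (hpred x k hs h hk)
      · exact .inr ⟨k, ih m (fun f hf => hV01 f hf.1) hs, hk, hcell x k h hk⟩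

theorem sum_choose_mul_pow_le {T N M : ℕ} (hM : 2 ≤ M)
    (h : ∀ t, T.choose (t + 1) * N ^ (t + 1) ≤ (M - 1) * M ^ (t + 1)) (D : ℕ) :
    ∑ t ∈ Finset.range (D + 1), T.choose t * N ^ t ≤ M ^ (D + 1) := by
  induction D with
  | zero => simp; omega
  | succ D ih =>
    rw [Finset.sum_range_succ]
    obtain ⟨M, rfl⟩ : ∃ K, M = K + 1 := ⟨M - 1, by omega⟩
    have := h D
    rw [Nat.add_sub_cancel] at this
    calc _ ≤ (M + 1) ^ (D + 1) + M * (M + 1) ^ (D + 1) := by gcongr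
      _ = _ := by ring

theorem two_pow_le_factorial_succ (t : ℕ) : 2 ^ t ≤ (t + 1).factorial := by
  induction t with
  | zero => simp
  | succ t ih =>
    rw [pow_succ, Nat.factorial_succ, mul_comm]
    gcongr
    omega

theorem two_pow_mul_choose_le (T t : ℕ) : 2 ^ t * T.choose (t + 1) ≤ T ^ (t + 1) :=
  calc _ ≤ (t + 1).factorial * T.choose (t + 1) := by
        gcongr
        exact two_pow_le_factorial_succ t
    _ = T.descFactorial (t + 1) := (Nat.descFactorial_eq_factorial_mul_choose _ _).symm
    _ ≤ _ := Nat.descFactorial_le_pow _ _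

theorem sum_choose_mul_ceil_pow_le {T : ℕ} (hT : 1 ≤ T) {c : ℝ} (hc : 3 / 2 < c) (D : ℕ) :
    ∑ t ∈ Finset.range (D + 1), T.choose t * ⌈c⌉₊ ^ t ≤ ⌈c * T⌉₊ ^ (D + 1) := by
  have hN : 2 ≤ ⌈c⌉₊ := Nat.lt_ceil.2 (by push_cast; linarith)
  rcases hT.eq_or_lt with rfl | hT
  · simp only [Nat.cast_one, mul_one]
    refine sum_choose_mul_pow_le hN (fun t => ?_) D
    gcongr
    rcases t with _ | t
    · simp; omega
    · simp [Nat.choose_eq_zero_of_lt]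
  · have hT' : (2 : ℝ) ≤ T := by exact_mod_cast hT
    have hM : 3 ≤ ⌈c * T⌉₊ := Nat.lt_ceil.2 (by push_cast; nlinarith)
    have hTN : T * ⌈c⌉₊ ≤ 2 * ⌈c * T⌉₊ := by
      have h₁ := Nat.ceil_lt_add_one (a := c) (by linarith)
      have h₂ := Nat.le_ceil (c * T)
      have h₃ : (T : ℝ) * ⌈c⌉₊ ≤ 2 * ⌈c * T⌉₊ := by nlinarith
      exact_mod_cast h₃
    refine sum_choose_mul_pow_le (by omega) (fun t => ?_) D
    refine le_of_mul_le_mul_left ?_ (pow_pos two_pos t)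
    calc 2 ^ t * (T.choose (t + 1) * ⌈c⌉₊ ^ (t + 1))
        = 2 ^ t * T.choose (t + 1) * ⌈c⌉₊ ^ (t + 1) := by ring
      _ ≤ T ^ (t + 1) * ⌈c⌉₊ ^ (t + 1) := by
        gcongr
        exact two_pow_mul_choose_le T t
      _ = (T * ⌈c⌉₊) ^ (t + 1) := (mul_pow _ _ _).symm
      _ ≤ (2 * ⌈c * T⌉₊) ^ (t + 1) := by gcongr
      _ = 2 ^ t * (2 * ⌈c * T⌉₊ ^ (t + 1)) := by ring
      _ ≤ _ := by
        gcongr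
        omega

/-- Lemma 6: if the sequential `(α/3)`-fat shattering number of `H` is at most `D`
(no tree of depth `D+1` is `(α/3)`-fat shattered), then there is a finite global
sequential `α`-covering set `G` of `H` at scale `T` with
`|G| ≤ Σ_{t=0}^{D} C(T,t) ⌈3/(2α)⌉^t ≤ ⌈3T/(2α)⌉^{D+1}`. -/
theorem exists_cover_of_fatShattering {X : Type*} (T : ℕ) (hT : 1 ≤ T)
    (α : ℝ) (hα : α ∈ Set.Ioo (0:ℝ) 1)
    (H : Set (X → ℝ)) (hH : ∀ h ∈ H, ∀ x, h x ∈ Set.Icc (0:ℝ) 1)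
    (D : ℕ) (hfat : ¬ ∃ τ : List Bool → X, FatShatters H (α / 3) (D + 1) τ) :
    ∃ G : Set (List X → ℝ), G.Finite ∧
      (∀ g ∈ G, ∀ l, g l ∈ Set.Icc (0:ℝ) 1) ∧
      IsGlobalSeqCover T H G α ∧
      Nat.card G ≤ ∑ t ∈ Finset.range (D + 1), T.choose t * ⌈3 / (2 * α)⌉₊ ^ t ∧
      (∑ t ∈ Finset.range (D + 1), T.choose t * ⌈3 / (2 * α)⌉₊ ^ t) ≤
        ⌈3 * (T : ℝ) / (2 * α)⌉₊ ^ (D + 1) := by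
  obtain ⟨hα₀, hα₁⟩ := hα
  have hsum := sum_choose_mul_ceil_pow_le hT (c := 3 / (2 * α))
    (by rw [lt_div_iff₀ (by positivity)]; linarith) D
  rw [show 3 / (2 * α) * (T : ℝ) = 3 * (T : ℝ) / (2 * α) by ring] at hsum
  rcases isEmpty_or_nonempty X with hX | hX
  · exact ⟨∅, Set.finite_empty, by simp, fun x => (hX.false (x ⟨0, hT⟩)).elim, by simp, hsum⟩
  have hN : 1 ≤ (⌈3 / (2 * α)⌉₊ : ℝ) * (2 * (α / 3)) := by
    have h := Nat.le_ceil (3 / (2 * α))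
    rw [div_le_iff₀ (by positivity)] at h
    linarith
  obtain ⟨g, hg, hcov⟩ := hasSeqCover_of_not_recFatShatters (by positivity) hN T D hH
    (fun h => hfat h.exists_fatShatters)
  refine ⟨Set.range g, Set.finite_range g, ?_, fun x h hh => ?_, ?_, hsum⟩
  · rintro _ ⟨i, rfl⟩ l
    exact hg i l
  · obtain ⟨i, hi⟩ := hcov (List.ofFn x) (by simp) h hh
    refine ⟨g i, ⟨i, rfl⟩, fun t => ?_⟩
    have := hi t (by simp)
    simpa [mul_div_cancel₀] using this
  · simpa using Finite.card_range_le g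
end

section
/- For s ≥ 1 and a time horizon T, let D_s = { p ∈ [0,1]^T : Σ_{t=1}^T p_t^s ≤ 1 }, regarded as a class of experts mapping the feature space {1,…,T} into [0,1] (the vector p maps t to p_t). Then there exists a constant c > 0, depending only on s, such that for all T ≥ 1 the fixed-design minimax regret under logarithmic loss satisfies r*_T(D_s) ≥ c·T^{s/(s+1)}. -/
open Set

/-- Fixed-design minimax regret `r*_T(H | x^T)`: the infimum over prediction
strategies `φ` (where `ŷ_t = φ_t(y^{t-1}, x^T) ∈ [0,1]`) of the supremum over
label sequences `y^T ∈ {0,1}^T` of the pointwise regret. -/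
noncomputable def fixedRegret {X : Type*} (H : Set (X → ℝ)) (T : ℕ)
    (x : Fin T → X) : EReal :=
  ⨅ φ : (t : Fin T) → (Fin (t : ℕ) → Bool) → Set.Icc (0:ℝ) 1,
    ⨆ y : Fin T → Bool,
      ((∑ t : Fin T,
          logLoss ((φ t fun i => y ⟨i.1, i.2.trans t.2⟩ : Set.Icc (0:ℝ) 1) : ℝ) (y t)) -
        ⨅ h ∈ H, ∑ t : Fin T, logLoss (h (x t)) (y t))

/-- Fixed-design maximal minimax regret `r*_T(H) = sup_{x^T} r*_T(H | x^T)`. -/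
noncomputable def fixedRegretSup {X : Type*} (H : Set (X → ℝ)) (T : ℕ) : EReal :=
  ⨆ x : Fin T → X, fixedRegret H T x

/-- The probability that a Bernoulli variable with parameter `p` equals `y`. -/
def bernoulliProb (p : ℝ) (y : Bool) : ℝ := if y then p else 1 - p

lemma bernoulliProb_nonneg {p : ℝ} (hp : p ∈ Icc (0 : ℝ) 1) (y : Bool) :
    0 ≤ bernoulliProb p y := by
  unfold bernoulliProb
  split_ifs <;> linarith [hp.1, hp.2]

lemma bernoulliProb_le_one {p : ℝ} (hp : p ∈ Icc (0 : ℝ) 1) (y : Bool) :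
    bernoulliProb p y ≤ 1 := by
  unfold bernoulliProb
  split_ifs <;> linarith [hp.1, hp.2]

lemma logLoss_eq_ite (p : ℝ) (y : Bool) :
    logLoss p y = if bernoulliProb p y = 0 then ⊤
      else ((-Real.log (bernoulliProb p y) : ℝ) : EReal) := by
  cases y
  · simp [logLoss, bernoulliProb, sub_eq_zero, eq_comm (a := (1 : ℝ))]
  · simp [logLoss, bernoulliProb]

lemma logLoss_nonneg {p : ℝ} (hp : p ∈ Icc (0 : ℝ) 1) (y : Bool) : 0 ≤ logLoss p y := by
  rw [logLoss_eq_ite]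
  split_ifs
  · exact le_top
  · exact EReal.coe_nonneg.2 (neg_nonneg.2
      (Real.log_nonpos (bernoulliProb_nonneg hp y) (bernoulliProb_le_one hp y)))

lemma EReal.coe_sum_real {ι : Type*} (F : Finset ι) (f : ι → ℝ) :
    ((∑ i ∈ F, f i : ℝ) : EReal) = ∑ i ∈ F, (f i : EReal) :=
  map_sum (⟨⟨Real.toEReal, EReal.coe_zero⟩, EReal.coe_add⟩ : ℝ →+ EReal) f F

/-- A forecast assigning probability at most `1 / M` to the observed labels has cumulative
logarithmic loss at least `log M`. -/
lemma log_le_sum_logLoss {ι : Type*} [Fintype ι] {p : ι → ℝ} (hp : ∀ t, p t ∈ Icc (0 : ℝ) 1)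
    (y : ι → Bool) {M : ℝ} (h : ∏ t, bernoulliProb (p t) (y t) ≤ 1 / M) :
    ((Real.log M : ℝ) : EReal) ≤ ∑ t, logLoss (p t) (y t) := by
  classical
  by_cases h0 : ∃ t, bernoulliProb (p t) (y t) = 0
  · obtain ⟨t, ht⟩ := h0
    calc ((Real.log M : ℝ) : EReal) ≤ ⊤ := le_top
      _ = logLoss (p t) (y t) := by rw [logLoss_eq_ite, if_pos ht]
      _ ≤ _ := Finset.single_le_sum (f := fun t => logLoss (p t) (y t))
        (fun i _ => logLoss_nonneg (hp i) (y i)) (Finset.mem_univ t)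
  · push Not at h0
    have hsum : ∑ t, logLoss (p t) (y t)
        = ((-Real.log (∏ t, bernoulliProb (p t) (y t)) : ℝ) : EReal) := by
      rw [Real.log_prod (fun i _ => h0 i), ← Finset.sum_neg_distrib]
      rw [EReal.coe_sum_real]
      exact Finset.sum_congr rfl fun t _ => by rw [logLoss_eq_ite, if_neg (h0 t)]
    rw [hsum, EReal.coe_le_coe_iff]
    have hpos : 0 < ∏ t, bernoulliProb (p t) (y t) :=
      Finset.prod_pos fun t _ => (bernoulliProb_nonneg (hp t) _).lt_of_ne' (h0 t)
    have := Real.log_le_log hpos h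
    rw [one_div, Real.log_inv] at this
    linarith

/-- The probabilities that a sequential forecaster assigns to label sequences sum to one. -/
lemma sum_prod_bernoulliProb (T : ℕ) (φ : (t : Fin T) → (Fin (t : ℕ) → Bool) → ℝ) :
    ∑ y : Fin T → Bool,
      ∏ t : Fin T, bernoulliProb (φ t fun i => y ⟨i.1, i.2.trans t.2⟩) (y t) = 1 := by
  induction T with
  | zero => simp
  | succ T ih =>
    rw [← Equiv.sum_comp (Fin.snocEquiv fun _ => Bool), Fintype.sum_prod_type,
      Finset.sum_comm]
    rw [← ih fun t => φ t.castSucc]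
    refine Finset.sum_congr rfl fun y _ => ?_
    have key (b : Bool) (t : Fin (T + 1)) :
        (fun i : Fin (t : ℕ) => (Fin.snoc y b : Fin (T + 1) → Bool) ⟨i.1, i.2.trans t.2⟩)
          = fun i => y ⟨i.1, by have := i.2; have := t.2; omega⟩ := by
      funext i
      exact Fin.snoc_castSucc (α := fun _ => Bool) b y
        ⟨i.1, by have := i.2; have := t.2; omega⟩
    simp only [Fin.snocEquiv_apply, key, Fin.prod_univ_castSucc, Fin.snoc_castSucc,
      Fin.snoc_last, Fintype.sum_bool, ← mul_add]
    simp [bernoulliProb]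

/-- If each label sequence in a finite family `F` is fitted by some expert with loss at most `L`,
then the fixed-design minimax regret is at least `log #F - L`. -/
lemma log_card_sub_le_fixedRegret {X : Type*} (H : Set (X → ℝ)) {T : ℕ} (x : Fin T → X)
    (F : Finset (Fin T → Bool)) (hF : F.Nonempty) (L : ℝ)
    (hL : ∀ y ∈ F, ∃ h ∈ H, ∑ t, logLoss (h (x t)) (y t) ≤ L) :
    ((Real.log F.card - L : ℝ) : EReal) ≤ fixedRegret H T x := by
  refine le_iInf fun φ => ?_
  have hcard : (0 : ℝ) < F.card := by exact_mod_cast hF.card_pos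
  let Q : (Fin T → Bool) → ℝ := fun y =>
    ∏ t : Fin T, bernoulliProb (φ t fun i => y ⟨i.1, i.2.trans t.2⟩ : Icc (0 : ℝ) 1) (y t)
  have hQ : ∑ y ∈ F, Q y ≤ ∑ _y ∈ F, 1 / (F.card : ℝ) := by
    rw [Finset.sum_const, nsmul_eq_mul, mul_one_div_cancel hcard.ne',
      ← sum_prod_bernoulliProb T fun t z => φ t z]
    exact Finset.sum_le_sum_of_subset_of_nonneg (Finset.subset_univ F)
      fun y _ _ => Finset.prod_nonneg fun t _ => bernoulliProb_nonneg (Subtype.prop _) _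
  obtain ⟨y, hyF, hy⟩ := Finset.exists_le_of_sum_le hF hQ
  refine le_iSup_of_le y ?_
  obtain ⟨h, hH, hhL⟩ := hL y hyF
  rw [EReal.coe_sub]
  exact EReal.sub_le_sub (log_le_sum_logLoss (fun t => Subtype.prop _) y hy)
    ((iInf₂_le h hH).trans hhL)

lemma pow_le_pow_mul_choose {n k : ℕ} (h : k ≤ n) : n ^ k ≤ k ^ k * n.choose k := by
  induction k generalizing n with
  | zero => simp
  | succ k ih =>
    obtain ⟨n, rfl⟩ : ∃ m, n = m + 1 := ⟨n - 1, by omega⟩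
    have hkn : k ≤ n := by omega
    rcases Nat.eq_zero_or_pos k with rfl | hk
    · simp
    have h1 : (n + 1) * k ≤ (k + 1) * n := by nlinarith
    refine Nat.le_of_mul_le_mul_left ?_ (pow_pos hk k)
    calc k ^ k * (n + 1) ^ (k + 1) = (n + 1) * ((n + 1) * k) ^ k := by rw [mul_pow]; ring
      _ ≤ (n + 1) * ((k + 1) * n) ^ k := by gcongr
      _ = (n + 1) * (k + 1) ^ k * n ^ k := by rw [mul_pow]; ring
      _ ≤ (n + 1) * (k + 1) ^ k * (k ^ k * n.choose k) := by gcongr; exact ih hkn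
      _ = (k + 1) ^ k * k ^ k * ((n + 1) * n.choose k) := by ring
      _ = (k + 1) ^ k * k ^ k * ((n + 1).choose (k + 1) * (k + 1)) := by
        rw [Nat.add_one_mul_choose_eq]
      _ = k ^ k * ((k + 1) ^ (k + 1) * (n + 1).choose (k + 1)) := by ring

/-- A label sequence with `k` ones is fitted by the expert equal to `k ^ (-1 / s)` on these ones
with loss `k / s * log k`. -/
lemma exists_expert_loss_le {s : ℝ} (hs : 0 < s) {T k : ℕ} (hk : 1 ≤ k) (A : Finset (Fin T))
    (hA : A.card ≤ k) :
    ∃ p ∈ {p : Fin T → ℝ | (∀ t, p t ∈ Icc (0 : ℝ) 1) ∧ ∑ t, p t ^ s ≤ 1},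
      ∑ t, logLoss (p t) (decide (t ∈ A)) ≤ ((k * (Real.log k / s) : ℝ) : EReal) := by
  have hk' : (1 : ℝ) ≤ k := by exact_mod_cast hk
  have hk0 : (0 : ℝ) < k := by linarith
  have hq : 0 < (k : ℝ) ^ (-(1 / s)) := Real.rpow_pos_of_pos hk0 _
  have hl : 0 ≤ Real.log k / s := div_nonneg (Real.log_nonneg hk') hs.le
  have hAk : (A.card : ℝ) ≤ k := by exact_mod_cast hA
  refine ⟨fun t => if t ∈ A then (k : ℝ) ^ (-(1 / s)) else 0, ⟨fun t => ?_, ?_⟩, ?_⟩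
  · dsimp only
    split_ifs
    · exact ⟨hq.le, Real.rpow_le_one_of_one_le_of_nonpos hk' (by
        rw [neg_nonpos]; positivity)⟩
    · simp
  · have : ∀ t, (if t ∈ A then (k : ℝ) ^ (-(1 / s)) else 0) ^ s
        = if t ∈ A then (k : ℝ)⁻¹ else 0 := by
      intro t
      split_ifs
      · rw [← Real.rpow_mul hk0.le, neg_mul, one_div_mul_cancel hs.ne', Real.rpow_neg_one]
      · exact Real.zero_rpow hs.ne'
    simp only [this, Finset.sum_ite_mem, Finset.univ_inter, Finset.sum_const, nsmul_eq_mul]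
    rw [← div_eq_mul_inv, div_le_one hk0]
    exact hAk
  · have : ∀ t, logLoss (if t ∈ A then (k : ℝ) ^ (-(1 / s)) else 0) (decide (t ∈ A))
        = ((if t ∈ A then Real.log k / s else 0 : ℝ) : EReal) := by
      intro t
      by_cases ht : t ∈ A
      · simp only [ht, decide_true, logLoss, if_true, hq.ne', if_false, Real.log_rpow hk0]
        congr 1
        ring
      · simp [ht, logLoss]
    simp only [this]
    rw [← EReal.coe_sum_real, EReal.coe_le_coe_iff]
    simp only [Finset.sum_ite_mem, Finset.univ_inter, Finset.sum_const, nsmul_eq_mul]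
    gcongr

/-- Lower bound on the regret from any family of label sequences with at most `k` ones each. -/
lemma log_card_sub_le_fixedRegretSup {s : ℝ} (hs : 0 < s) {T k : ℕ} (hk : 1 ≤ k)
    (G : Finset (Finset (Fin T))) (hG : G.Nonempty) (hGk : ∀ A ∈ G, A.card ≤ k) :
    ((Real.log G.card - k * (Real.log k / s) : ℝ) : EReal) ≤
      fixedRegretSup
        {p : Fin T → ℝ | (∀ t, p t ∈ Icc (0 : ℝ) 1) ∧ ∑ t, p t ^ s ≤ 1} T := by
  refine le_iSup_of_le id ?_
  have hinj : Function.Injective fun (A : Finset (Fin T)) (t : Fin T) => decide (t ∈ A) := by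
    intro A B h
    ext t
    simpa using congrFun h t
  rw [← Finset.card_map ⟨_, hinj⟩]
  refine log_card_sub_le_fixedRegret _ _ _ (by simpa using hG) _ fun y hy => ?_
  obtain ⟨A, hAG, rfl⟩ := Finset.mem_map.1 hy
  exact exists_expert_loss_le hs hk A (hGk A hAG)

lemma le_log_choose_sub {s : ℝ} (hs : 0 < s) {T k : ℕ} (hk : 1 ≤ k) (hkT : k ≤ T)
    (hka : (k : ℝ) ≤ ((T : ℝ) / Real.exp 1) ^ (s / (s + 1))) :
    (k : ℝ) ≤ Real.log (T.choose k) - k * (Real.log k / s) := by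
  have hk0 : (0 : ℝ) < k := by exact_mod_cast hk
  have hT0 : (0 : ℝ) < T := by exact_mod_cast hk.trans hkT
  have hC : (0 : ℝ) < T.choose k := by exact_mod_cast Nat.choose_pos hkT
  have h1 : (k : ℝ) * Real.log T ≤ k * Real.log k + Real.log (T.choose k) := by
    have h : (T : ℝ) ^ k ≤ (k : ℝ) ^ k * T.choose k := by
      exact_mod_cast pow_le_pow_mul_choose hkT
    have := Real.log_le_log (by positivity) h
    rwa [Real.log_mul (by positivity) hC.ne', Real.log_pow, Real.log_pow] at this
  have h2 : Real.log k + Real.log k / s ≤ Real.log T - 1 := by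
    have := Real.log_le_log hk0 hka
    rw [Real.log_rpow (by positivity), Real.log_div hT0.ne' (Real.exp_pos 1).ne',
      Real.log_exp] at this
    calc Real.log k + Real.log k / s = (s + 1) / s * Real.log k := by field_simp
      _ ≤ (s + 1) / s * (s / (s + 1) * (Real.log T - 1)) := by gcongr
      _ = Real.log T - 1 := by field_simp
  nlinarith [mul_le_mul_of_nonneg_left h2 hk0.le]

/-- Theorem 8: for `D_s = { p ∈ [0,1]^T : Σ_t p_t^s ≤ 1 }`, viewed as experts on
the feature space `{1,…,T}`, there is a constant `c > 0` depending only on `s`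
with `r*_T(D_s) ≥ c T^{s/(s+1)}` for all `T ≥ 1`. -/
theorem fixedRegret_Ds_lower (s : ℝ) (hs : 1 ≤ s) :
    ∃ c : ℝ, 0 < c ∧ ∀ T : ℕ, 1 ≤ T →
      ((c * (T : ℝ) ^ (s / (s + 1)) : ℝ) : EReal) ≤
        fixedRegretSup
          {p : Fin T → ℝ | (∀ t, p t ∈ Set.Icc (0:ℝ) 1) ∧ ∑ t, p t ^ s ≤ 1} T := by
  have hs0 : 0 < s := by linarith
  have hα : 0 ≤ s / (s + 1) := by positivity
  have hα1 : s / (s + 1) ≤ 1 := (div_le_one (by linarith)).2 (by linarith)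
  refine ⟨1 / 2 * (Real.exp 1)⁻¹ ^ (s / (s + 1)), by positivity, fun T hT => ?_⟩
  have hT0 : (0 : ℝ) < T := by exact_mod_cast hT
  rw [mul_assoc, ← Real.mul_rpow (by positivity) hT0.le, inv_mul_eq_div]
  set a : ℝ := ((T : ℝ) / Real.exp 1) ^ (s / (s + 1)) with ha
  rcases lt_or_ge a 1 with ha1 | ha1
  · have hne : (∅ : Finset (Fin T)) ≠ {⟨0, hT⟩} := (Finset.singleton_ne_empty _).symm
    refine le_trans ?_ (log_card_sub_le_fixedRegretSup hs0 le_rfl {∅, {⟨0, hT⟩}} (by simp)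
      (by simp))
    rw [Finset.card_pair hne, EReal.coe_le_coe_iff]
    norm_num
    linarith [Real.log_two_gt_d9]
  · have hk : 1 ≤ ⌊a⌋₊ := (Nat.one_le_floor_iff a).2 ha1
    have hka : (⌊a⌋₊ : ℝ) ≤ a := Nat.floor_le (by linarith)
    have hTe : 1 ≤ (T : ℝ) / Real.exp 1 := by
      by_contra! h
      exact absurd ha1 (not_le.2 (Real.rpow_lt_one (by positivity) h (by positivity)))
    have hkT : ⌊a⌋₊ ≤ T := by
      have h1 : a ≤ (T : ℝ) / Real.exp 1 := by
        simpa using Real.rpow_le_rpow_of_exponent_le hTe hα1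
      have h2 : (T : ℝ) / Real.exp 1 ≤ T := div_le_self hT0.le (Real.one_le_exp zero_le_one)
      exact_mod_cast hka.trans (h1.trans h2)
    refine le_trans ?_ (log_card_sub_le_fixedRegretSup hs0 hk
      (Finset.univ.powersetCard ⌊a⌋₊) (Finset.powersetCard_nonempty.2 (by simpa using hkT))
      fun A hA => (Finset.mem_powersetCard.1 hA).2.le)
    rw [Finset.card_powersetCard, Finset.card_univ, Fintype.card_fin, EReal.coe_le_coe_iff]
    refine le_trans ?_ (le_log_choose_sub hs0 hk hkT hka)
    have hk1 : (1 : ℝ) ≤ ⌊a⌋₊ := by exact_mod_cast hk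
    linarith [Nat.lt_floor_add_one a]
end

section
/- Let α ∈ (0,1], let H be a class of functions X → [0,1], let T be a time horizon, and let G be a global sequential α-covering of H at scale T. For g ∈ G define the smooth truncation g̃ by g̃(x^t) = (g(x^t) + α)/(1 + 2α). Then for every x^T ∈ X^T, every y^T ∈ {0,1}^T and every h ∈ H, there exists g ∈ G such that p_h(y^T|x^T) / p_{g̃}(y^T|x^T) ≤ (1 + 2α)^T, where p_h(y^T|x^T) = Π_{t=1}^T h(x_t)^{y_t}(1−h(x_t))^{1−y_t} and p_{g̃}(y^T|x^T) = Π_{t=1}^T g̃(x^t)^{y_t}(1−g̃(x^t))^{1−y_t}. -/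
open Set

/-- The likelihood ratio of a single observation against the smooth truncation of an
`α`-close prediction lies between `0` and `1 + 2α`. -/
theorem smoothTruncation_factor_bounds {α p q : ℝ} (hα : 0 < α)
    (hp : p ∈ Set.Icc (0 : ℝ) 1) (hq : q ∈ Set.Icc (0 : ℝ) 1) (hpq : |p - q| ≤ α) (b : Bool) :
    0 ≤ (if b then p else 1 - p) /
        (if b then (q + α) / (1 + 2 * α) else 1 - (q + α) / (1 + 2 * α)) ∧
      (if b then p else 1 - p) /
        (if b then (q + α) / (1 + 2 * α) else 1 - (q + α) / (1 + 2 * α)) ≤ 1 + 2 * α := by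
  obtain ⟨hp0, hp1⟩ := hp
  obtain ⟨hq0, hq1⟩ := hq
  obtain ⟨hlo, hhi⟩ := abs_le.mp hpq
  have hpos : 0 < 1 + 2 * α := by linarith
  have hcompl : 1 - (q + α) / (1 + 2 * α) = (1 - q + α) / (1 + 2 * α) := by
    field_simp
    ring
  have bounds : ∀ u v : ℝ, 0 ≤ u → 0 < v → u ≤ v →
      0 ≤ u / (v / (1 + 2 * α)) ∧ u / (v / (1 + 2 * α)) ≤ 1 + 2 * α := by
    intro u v hu hv huv
    refine ⟨by positivity, ?_⟩
    rw [div_le_iff₀ (by positivity), mul_div_cancel₀ _ hpos.ne']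
    exact huv
  rw [hcompl]
  cases b
  · simpa using bounds (1 - p) (1 - q + α) (by linarith) (by linarith) (by linarith)
  · simpa using bounds p (q + α) hp0 (by linarith) (by linarith)

/-- Lemma 4 (smooth truncation): if `G` is a global sequential `α`-covering of `H`
at scale `T` and `g̃(x^t) = (g(x^t) + α)/(1 + 2α)` is the smooth truncation, then
for all `x^T`, `y^T` and `h ∈ H` there is `g ∈ G` with
`p_h(y^T|x^T) / p_{g̃}(y^T|x^T) ≤ (1 + 2α)^T`. -/
theorem smooth_truncation_ratio {X : Type*} (α : ℝ) (hα : 0 < α) (hα1 : α ≤ 1)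
    (T : ℕ)
    (H : Set (X → ℝ)) (hH : ∀ h ∈ H, ∀ x, h x ∈ Set.Icc (0:ℝ) 1)
    (G : Set (List X → ℝ)) (hG : ∀ g ∈ G, ∀ l, g l ∈ Set.Icc (0:ℝ) 1)
    (hcov : IsGlobalSeqCover T H G α) :
    ∀ (x : Fin T → X) (y : Fin T → Bool), ∀ h ∈ H, ∃ g ∈ G,
      (∏ t : Fin T, (if y t then h (x t) else 1 - h (x t))) /
        (∏ t : Fin T,
          (if y t then (g ((List.ofFn x).take (t.1 + 1)) + α) / (1 + 2 * α)
           else 1 - (g ((List.ofFn x).take (t.1 + 1)) + α) / (1 + 2 * α))) ≤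
      (1 + 2 * α) ^ T := by
  intro x y h hh
  obtain ⟨g, hg, hclose⟩ := hcov x h hh
  refine ⟨g, hg, ?_⟩
  rw [← Finset.prod_div_distrib]
  refine (Finset.prod_le_prod (g := fun _ => 1 + 2 * α) ?_ ?_).trans_eq (by simp)
  · intro t _
    exact (smoothTruncation_factor_bounds hα (hH h hh _) (hG g hg _) (hclose t) _).1
  · intro t _
    exact (smoothTruncation_factor_bounds hα (hH h hh _) (hG g hg _) (hclose t) _).2
end

section
/- Let X be a countable set and let P be a finite nonempty set of probability mass functions on X. Define the Shtarkov sum S = Σ_{x∈X} max_{p∈P} p(x). Then for every estimation rule Φ: X → P, max_{p∈P} p( { x ∈ X : Φ(x) ≠ p } ) ≥ 1 − S/|P|. -/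
open Set

/-- Lemma (Shtarkov lower bound for identification): for a finite nonempty family
`P` of probability mass functions on a countable set `X` with Shtarkov sum
`S = Σ_x max_{p∈P} p(x)`, every estimation rule `Φ : X → P` has worst-case error
probability at least `1 - S/|P|`. -/
theorem shtarkov_identification_lower {X : Type*} [Countable X]
    (P : Finset (X → ℝ)) (hne : P.Nonempty)
    (hnonneg : ∀ p ∈ P, ∀ x, 0 ≤ p x)
    (hsum : ∀ p ∈ P, HasSum p 1)
    (Φ : X → (X → ℝ)) (hΦ : ∀ x, Φ x ∈ P) :
    ∃ p ∈ P,
      1 - (∑' x, P.sup' hne fun q => q x) / (P.card : ℝ) ≤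
        ∑' x, Set.indicator {x | Φ x ≠ p} p x := by
  classical
  have hsummable_sum : Summable fun x => ∑ p ∈ P, p x :=
    summable_sum fun p hp => (hsum p hp).summable
  have hsup_nonneg : ∀ x, 0 ≤ P.sup' hne fun q => q x := fun x =>
    (hnonneg _ (hΦ x) x).trans (Finset.le_sup' (fun q : X → ℝ => q x) (hΦ x))
  have hsummable_sup : Summable fun x => P.sup' hne fun q => q x := by
    refine Summable.of_nonneg_of_le hsup_nonneg (fun x => ?_) hsummable_sum
    exact Finset.sup'_le _ _ fun q hq =>
      Finset.single_le_sum (f := fun p : X → ℝ => p x) (fun p hp => hnonneg p hp x) hq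
  have hsummable_error : ∀ p ∈ P, Summable (Set.indicator {x | Φ x ≠ p} p) :=
    fun p hp => (hsum p hp).summable.indicator _
  have hcard : (P.card : ℝ) ≠ 0 := by
    exact_mod_cast hne.card_pos.ne'
  have hpointwise : ∀ x, ∑ p ∈ P, p x ≤
      (∑ p ∈ P, Set.indicator {x | Φ x ≠ p} p x) + P.sup' hne fun q => q x := by
    intro x
    rw [← Finset.add_sum_erase P (fun p => p x) (hΦ x),
      ← Finset.add_sum_erase P (fun p => Set.indicator {x | Φ x ≠ p} p x) (hΦ x)]
    have herase : ∑ p ∈ P.erase (Φ x), Set.indicator {x | Φ x ≠ p} p x =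
        ∑ p ∈ P.erase (Φ x), p x :=
      Finset.sum_congr rfl fun p hp =>
        Set.indicator_of_mem (s := {x | Φ x ≠ p}) (Finset.ne_of_mem_erase hp).symm p
    have hself : Set.indicator {y | Φ y ≠ Φ x} (Φ x) x = 0 := by simp
    have hle : Φ x x ≤ P.sup' hne fun q => q x :=
      Finset.le_sup' (fun q : X → ℝ => q x) (hΦ x)
    rw [herase, hself]
    linarith
  refine Finset.exists_le_of_sum_le hne ?_
  have htotal : ∑' x, ∑ p ∈ P, p x = P.card := by
    rw [Summable.tsum_finsetSum fun p hp => (hsum p hp).summable,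
      Finset.sum_congr rfl fun p hp => (hsum p hp).tsum_eq]
    simp
  have hle := hsummable_sum.tsum_le_tsum hpointwise
    ((summable_sum hsummable_error).add hsummable_sup)
  rw [htotal, (summable_sum hsummable_error).tsum_add hsummable_sup,
    Summable.tsum_finsetSum hsummable_error] at hle
  rw [Finset.sum_const, nsmul_eq_mul, mul_sub, mul_one, mul_div_cancel₀ _ hcard]
  linarith
end

section
/- Fix c₁, c₂ ∈ (0,1) with c₁ + c₂ < 1, and fix r > 0. There exists a constant C > 0 depending only on c₁ and c₂ such that for all sufficiently large integers d and all positive integers n with c₂·n ≥ d^r: Σ_{y∈{0,1}^n} sup_{ w ∈ [c₁ − c₂·d^{−r}, c₁ + c₂·d^{−r}] } w^{k(y)}·(1−w)^{n−k(y)} ≥ C·√( n / d^{2r} ), where k(y) denotes the number of ones in the binary string y. -/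
open Set

/-- Stirling's upper bound, in a form that also holds at `m = 0`. -/
theorem factorial_le_exp_mul_sqrt_succ (m : ℕ) :
    (m.factorial : ℝ) ≤
      Real.exp 1 * Real.sqrt ((m : ℝ) + 1) * ((m : ℝ) / Real.exp 1) ^ m := by
  rcases m with _ | j
  · simp
  · have h : Stirling.stirlingSeq (j + 1) ≤ Stirling.stirlingSeq 1 :=
      Stirling.stirlingSeq'_antitone (Nat.zero_le j)
    rw [Stirling.stirlingSeq_one, Stirling.stirlingSeq] at h
    rw [div_le_iff₀ (by positivity)] at h
    refine h.trans ?_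
    rw [Real.sqrt_mul (by norm_num), ← mul_assoc, ← mul_assoc]
    have h2 : Real.sqrt 2 ≠ 0 := by positivity
    rw [div_mul_cancel₀ _ h2]
    gcongr
    linarith

/-- At its mode `k`, the binomial distribution with parameters `n` and `k / n` has mass of order
at least `1 / √n`. -/
theorem le_choose_mul_pow_mul_pow {n k : ℕ} (hn : 0 < n) (hk : k ≤ n) :
    1 / (Real.exp 1 ^ 2 * Real.sqrt n) ≤
      (n.choose k : ℝ) * (((k : ℝ) / n) ^ k * (1 - (k : ℝ) / n) ^ (n - k)) := by
  obtain ⟨l, rfl⟩ := Nat.exists_eq_add_of_le hk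
  rw [Nat.add_sub_cancel_left]
  have hN : (1 : ℝ) ≤ ((k + l : ℕ) : ℝ) := by exact_mod_cast hn
  have hl : 1 - (k : ℝ) / ((k + l : ℕ) : ℝ) = (l : ℝ) / ((k + l : ℕ) : ℝ) := by
    field_simp
    push_cast
    ring
  rw [hl]
  have hlow := Stirling.le_factorial_stirling (k + l)
  have hkf := factorial_le_exp_mul_sqrt_succ k
  have hlf := factorial_le_exp_mul_sqrt_succ l
  have hfac : ((k + l).factorial : ℝ) = (k + l).choose k * k.factorial * l.factorial := by
    have := Nat.choose_mul_factorial_mul_factorial (Nat.le_add_right k l)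
    rw [Nat.add_sub_cancel_left] at this
    exact_mod_cast this.symm
  have hsqrt : Real.sqrt ((k : ℝ) + 1) * Real.sqrt ((l : ℝ) + 1) ≤ 3 / 2 * ((k + l : ℕ) : ℝ) := by
    rw [← Real.sqrt_mul (by positivity)]
    apply Real.sqrt_le_iff.2
    constructor
    · positivity
    · push_cast at hN ⊢
      nlinarith [sq_nonneg ((k : ℝ) - l)]
  have hpi : 3 / 2 * Real.sqrt ((k + l : ℕ) : ℝ)
      ≤ Real.sqrt (2 * Real.pi * ((k + l : ℕ) : ℝ)) := by
    apply Real.le_sqrt_of_sq_le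
    rw [mul_pow, Real.sq_sqrt (by positivity)]
    nlinarith [Real.pi_gt_three]
  generalize hNdef : ((k + l : ℕ) : ℝ) = N at *
  set B : ℝ := ((k + l).choose k : ℝ)
  have hB0 : 0 ≤ B := by positivity
  have hN0 : 0 < N := by linarith
  have hsN : 0 < Real.sqrt N := Real.sqrt_pos.2 hN0
  set e := Real.exp 1
  have he0 : 0 < e := Real.exp_pos 1
  have hmain : 3 / 2 * Real.sqrt N * (N / e) ^ (k + l) ≤
      B * e ^ 2 * (3 / 2 * N) * ((k / e) ^ k * (l / e) ^ l) := by
    calc 3 / 2 * Real.sqrt N * (N / e) ^ (k + l)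
        ≤ Real.sqrt (2 * Real.pi * N) * (N / e) ^ (k + l) := by gcongr
      _ ≤ B * k.factorial * l.factorial := hfac ▸ hlow
      _ ≤ B * (e * Real.sqrt ((k : ℝ) + 1) * (k / e) ^ k) *
            (e * Real.sqrt ((l : ℝ) + 1) * (l / e) ^ l) := by gcongr
      _ = B * e ^ 2 * (Real.sqrt ((k : ℝ) + 1) * Real.sqrt ((l : ℝ) + 1)) *
            ((k / e) ^ k * (l / e) ^ l) := by ring
      _ ≤ _ := by gcongr
  have hscale : ((k : ℝ) / e) ^ k * (l / e) ^ l =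
      (N / e) ^ (k + l) * ((k / N) ^ k * (l / N) ^ l) := by
    simp only [div_pow, pow_add]
    field_simp
  rw [hscale] at hmain
  have hpow : 0 < (N / e) ^ (k + l) := by positivity
  set P := ((k : ℝ) / N) ^ k * (l / N) ^ l
  have hred : Real.sqrt N ≤ B * e ^ 2 * N * P := by
    refine le_of_mul_le_mul_left ?_ (mul_pos (by norm_num : (0 : ℝ) < 3 / 2) hpow)
    linarith
  rw [div_le_iff₀ (by positivity)]
  refine le_of_mul_le_mul_left ?_ hsN
  have hss := Real.mul_self_sqrt hN0.le
  calc Real.sqrt N * 1 ≤ B * e ^ 2 * N * P := by linarith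
    _ = Real.sqrt N * (B * P * (e ^ 2 * Real.sqrt N)) := by
      nth_rewrite 1 [← hss]
      ring

/-- A sum over binary strings of a function of the number of ones, grouped by that number. -/
theorem sum_bool_card_filter (n : ℕ) (f : ℕ → ℝ) :
    ∑ y : Fin n → Bool, f (Finset.univ.filter fun t => y t = true).card =
      ∑ k ∈ Finset.range (n + 1), (n.choose k : ℝ) * f k := by
  have h := Finset.sum_powerset_apply_card f (x := (Finset.univ : Finset (Fin n)))
  simp only [Finset.card_univ, Fintype.card_fin, nsmul_eq_mul] at h
  rw [← h]
  refine Finset.sum_bij' (fun y _ => Finset.univ.filter fun t => y t = true)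
    (fun s _ t => decide (t ∈ s)) ?_ ?_ ?_ ?_ ?_ <;> simp

/-- The number of naturals in `[a, b]` is at least `b - a - 1`. -/
theorem sub_sub_one_le_card_Icc_ceil_floor {a b : ℝ} (ha : 0 ≤ a) :
    b - a - 1 ≤ ((Finset.Icc ⌈a⌉₊ ⌊b⌋₊).card : ℝ) := by
  rw [Nat.card_Icc]
  have h1 := Nat.ceil_lt_add_one ha
  have h2 := Nat.lt_floor_add_one b
  have h3 : ((⌊b⌋₊ + 1 : ℕ) : ℝ) - (⌈a⌉₊ : ℝ) ≤ ((⌊b⌋₊ + 1 - ⌈a⌉₊ : ℕ) : ℝ) := by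
    rw [sub_le_iff_le_add]
    exact_mod_cast le_tsub_add
  push_cast at h3
  linarith

/-- The Shtarkov sum of the Bernoulli measures with parameter in `[c - δ, c + δ]` is of order at
least `δ √n`. -/
theorem mul_sqrt_le_bernoulli_shtarkov_sum {c δ : ℝ} {n : ℕ} (h0 : 0 ≤ c - δ) (h1 : c + δ ≤ 1)
    (hδ : 1 ≤ n * δ) :
    δ * Real.sqrt n / Real.exp 1 ^ 2 ≤
      ∑ y : Fin n → Bool,
        sSup ((fun w : ℝ =>
            w ^ (Finset.univ.filter fun t => y t = true).card *
              (1 - w) ^ (n - (Finset.univ.filter fun t => y t = true).card)) ''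
          Set.Icc (c - δ) (c + δ)) := by
  have hn : 0 < n := by
    rcases Nat.eq_zero_or_pos n with rfl | h
    · norm_num at hδ
    · exact h
  have hn' : (0 : ℝ) < n := by exact_mod_cast hn
  rw [sum_bool_card_filter n (fun k => sSup ((fun w : ℝ => w ^ k * (1 - w) ^ (n - k)) ''
    Set.Icc (c - δ) (c + δ)))]
  set K := Finset.Icc ⌈(n : ℝ) * (c - δ)⌉₊ ⌊(n : ℝ) * (c + δ)⌋₊ with hK
  have hKn : ∀ k ∈ K, k ≤ n := fun k hk =>
    (Finset.mem_Icc.1 hk).2.trans (Nat.floor_le_of_le (by nlinarith))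
  have hcard : n * δ ≤ (K.card : ℝ) := by
    have := sub_sub_one_le_card_Icc_ceil_floor (b := (n : ℝ) * (c + δ)) (mul_nonneg hn'.le h0)
    linarith
  calc δ * Real.sqrt n / Real.exp 1 ^ 2
      = n * δ * (1 / (Real.exp 1 ^ 2 * Real.sqrt n)) := by
        have hs : Real.sqrt n ≠ 0 := (Real.sqrt_pos.2 hn').ne'
        field_simp
        rw [Real.sq_sqrt hn'.le]
    _ ≤ K.card * (1 / (Real.exp 1 ^ 2 * Real.sqrt n)) := by gcongr
    _ = ∑ k ∈ K, 1 / (Real.exp 1 ^ 2 * Real.sqrt n) := by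
        rw [Finset.sum_const, nsmul_eq_mul]
    _ ≤ ∑ k ∈ K, (n.choose k : ℝ) * sSup ((fun w : ℝ => w ^ k * (1 - w) ^ (n - k)) ''
          Set.Icc (c - δ) (c + δ)) := by
        refine Finset.sum_le_sum fun k hk =>
          (le_choose_mul_pow_mul_pow hn (hKn k hk)).trans ?_
        gcongr
        refine le_csSup (isCompact_Icc.bddAbove_image (by fun_prop))
          ⟨(k : ℝ) / n, ⟨?_, ?_⟩, rfl⟩
        · rw [le_div_iff₀ hn', mul_comm]
          exact Nat.ceil_le.1 (Finset.mem_Icc.1 hk).1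
        · rw [div_le_iff₀ hn', mul_comm]
          exact (Nat.le_floor_iff (mul_nonneg hn'.le (by nlinarith))).1 (Finset.mem_Icc.1 hk).2
    _ ≤ _ := by
        refine Finset.sum_le_sum_of_subset_of_nonneg
          (fun k hk => Finset.mem_range_succ_iff.2 (hKn k hk)) fun k _ _ =>
            mul_nonneg (Nat.cast_nonneg _) (Real.sSup_nonneg ?_)
        rintro _ ⟨w, ⟨hw0, hw1⟩, rfl⟩
        exact mul_nonneg (pow_nonneg (by linarith) _) (pow_nonneg (by linarith) _)

/-- Lemma 7: for fixed `c₁, c₂ ∈ (0,1)` with `c₁ + c₂ < 1` there is a constant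
`C > 0`, depending only on `c₁` and `c₂`, such that for every `r > 0`, for all
sufficiently large `d` and all `n` with `c₂ n ≥ d^r`,
`Σ_{y ∈ {0,1}^n} sup_{w ∈ [c₁ - c₂ d^{-r}, c₁ + c₂ d^{-r}]} w^{k(y)} (1-w)^{n-k(y)}
  ≥ C √(n / d^{2r})`, where `k(y)` is the number of ones in `y`. -/
theorem bernoulli_shtarkov_sum_lower (c₁ c₂ : ℝ)
    (hc₁ : c₁ ∈ Set.Ioo (0:ℝ) 1) (hc₂ : c₂ ∈ Set.Ioo (0:ℝ) 1)
    (hsum : c₁ + c₂ < 1) :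
    ∃ C : ℝ, 0 < C ∧ ∀ r : ℝ, 0 < r → ∃ D : ℕ, ∀ d : ℕ, D ≤ d →
      ∀ n : ℕ, (d : ℝ) ^ r ≤ c₂ * (n : ℝ) →
        C * Real.sqrt ((n : ℝ) / (d : ℝ) ^ (2 * r)) ≤
          ∑ y : Fin n → Bool,
            sSup ((fun w : ℝ =>
                w ^ (Finset.univ.filter fun t => y t = true).card *
                  (1 - w) ^ (n - (Finset.univ.filter fun t => y t = true).card)) ''
              Set.Icc (c₁ - c₂ * (d : ℝ) ^ (-r)) (c₁ + c₂ * (d : ℝ) ^ (-r))) := by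
  obtain ⟨h10, h11⟩ := hc₁
  obtain ⟨h20, h21⟩ := hc₂
  refine ⟨c₂ / Real.exp 1 ^ 2, by positivity, fun r hr => ?_⟩
  have htend : Filter.Tendsto (fun d : ℕ => (d : ℝ) ^ (-r)) Filter.atTop (nhds 0) :=
    (tendsto_rpow_neg_atTop hr).comp tendsto_natCast_atTop_atTop
  obtain ⟨D, hD⟩ := Filter.eventually_atTop.1
    ((htend.eventually (eventually_le_nhds h10)).and (Filter.eventually_ge_atTop 1))
  refine ⟨D, fun d hd n hn => ?_⟩
  obtain ⟨hdc, hd1⟩ := hD d hd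
  have hd0 : (0 : ℝ) < d := by exact_mod_cast hd1
  have hinv : (d : ℝ) ^ (-r) = ((d : ℝ) ^ r)⁻¹ := Real.rpow_neg hd0.le r
  have hpos : 0 < (d : ℝ) ^ r := Real.rpow_pos_of_pos hd0 r
  have hsqrt : Real.sqrt ((n : ℝ) / (d : ℝ) ^ (2 * r)) = Real.sqrt n * (d : ℝ) ^ (-r) := by
    rw [Real.sqrt_div n.cast_nonneg, two_mul, Real.rpow_add hd0, Real.sqrt_mul_self hpos.le,
      hinv, div_eq_mul_inv]
  have hx0 : 0 < (d : ℝ) ^ (-r) := Real.rpow_pos_of_pos hd0 _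
  have hx1 : (d : ℝ) ^ (-r) ≤ 1 := hdc.trans h11.le
  have hδ : 1 ≤ (n : ℝ) * (c₂ * (d : ℝ) ^ (-r)) := by
    rw [hinv, ← mul_assoc, ← div_eq_mul_inv, one_le_div hpos]
    linarith
  refine le_trans (le_of_eq ?_)
    (mul_sqrt_le_bernoulli_shtarkov_sum (by nlinarith) (by nlinarith) hδ)
  rw [hsqrt]
  ring
end

section
/- Fix α > 0, an integer K ≤ ⌈1/(2α)⌉, and grid points z₁ < ⋯ < z_K in [0,1] with z_{k+1} − z_k = 2α for all k < K and such that every point of [0,1] is within α of some z_k. Let H be a class of functions X → [0,1] and let H' be a discretized class consisting of, for each h ∈ H, a function h': X → {1,…,K} satisfying |z_{h'(x)} − h(x)| = min_{k∈{1,…,K}} |z_k − h(x)| for all x ∈ X. Then the discretized 1-shattering number FAT₁(H') is at most the sequential α-fat shattering number of H. -/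
open Set

/-- A class `H'` of `{1,…,K}`-valued (here `ℕ`-valued) functions `1`-shatters the
binary tree `τ` of depth `n`. -/
def IntShatters {X : Type*} (H' : Set (X → ℕ)) (n : ℕ)
    (τ : List Bool → X) : Prop :=
  ∃ s : List Bool → ℕ, ∀ ε : Fin n → Bool, ∃ h' ∈ H', ∀ t : Fin n,
    (ε t = false →
      h' (τ ((List.ofFn ε).take t.1)) + 1 ≤ s ((List.ofFn ε).take t.1)) ∧
    (ε t = true →
      s ((List.ofFn ε).take t.1) + 1 ≤ h' (τ ((List.ofFn ε).take t.1)))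

/-- Lemma 8: the discretized `1`-shattering number of the discretized class
`H' = D '' H` (where `D h` picks, at each `x`, an index of a grid point nearest
to `h x`) is at most the sequential `α`-fat shattering number of `H`: every tree
`1`-shattered by `H'` at some depth `n` yields a tree `α`-fat shattered by `H`
at the same depth. -/
theorem intShattering_le_fatShattering {X : Type*}
    (α : ℝ) (hα : 0 < α) (K : ℕ) (hK0 : 0 < K) (hK : K ≤ ⌈1 / (2 * α)⌉₊
    )
    (z : ℕ → ℝ)
    (hz : ∀ k, 1 ≤ k → k ≤ K → z k ∈ Set.Icc (0:ℝ) 1)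
    (hgap : ∀ k, 1 ≤ k → k < K → z (k + 1) - z k = 2 * α)
    (hnear : ∀ v ∈ Set.Icc (0:ℝ) 1, ∃ k, 1 ≤ k ∧ k ≤ K ∧ |z k - v| ≤ α)
    (H : Set (X → ℝ)) (hH : ∀ h ∈ H, ∀ x, h x ∈ Set.Icc (0:ℝ) 1)
    (D : (X → ℝ) → (X → ℕ))
    (hD : ∀ h ∈ H, ∀ x : X, (1 ≤ D h x ∧ D h x ≤ K) ∧
      ∀ k, 1 ≤ k → k ≤ K → |z (D h x) - h x| ≤ |z k - h x|)
    (H' : Set (X → ℕ)) (hH' : H' = D '' H) :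
    ∀ n : ℕ, (∃ τ : List Bool → X, IntShatters H' n τ) →
      ∃ τ : List Bool → X, FatShatters H α n τ := by
  rintro n ⟨τ, s, hs⟩
  subst hH'
  have hlin : ∀ k, 1 ≤ k → k ≤ K → z k = z 1 + 2 * α * ((k : ℝ) - 1) := by
    intro k hk
    induction k, hk using Nat.le_induction with
    | base => intro _; simp
    | succ k hk ih =>
      intro hkK
      have h₁ := ih (by omega)
      have h₂ := hgap k hk (by omega)
      push_cast
      linarith
  have hclose : ∀ h ∈ H, ∀ x, |z 1 + 2 * α * ((D h x : ℝ) - 1) - h x| ≤ α := by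
    intro h hh x
    obtain ⟨⟨hD1, hDK⟩, hmin⟩ := hD h hh x
    obtain ⟨k, hk1, hkK, hk⟩ := hnear (h x) (hH h hh x)
    rw [← hlin _ hD1 hDK]
    exact (hmin k hk1 hkK).trans hk
  refine ⟨τ, fun l => z 1 + 2 * α * ((s l : ℝ) - 1), fun ε => ?_⟩
  obtain ⟨_, ⟨h, hh, rfl⟩, hsh⟩ := hs ε
  refine ⟨h, hh, fun t => ⟨fun ht => ?_, fun ht => ?_⟩⟩
  · have hle := (hsh t).1 ht
    have hle' : (D h (τ ((List.ofFn ε).take t.1)) : ℝ) + 1 ≤ s ((List.ofFn ε).take t.1) := by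
      exact_mod_cast hle
    have habs := abs_le.mp (hclose h hh (τ ((List.ofFn ε).take t.1)))
    have hmul := mul_le_mul_of_nonneg_left hle' hα.le
    linarith [habs.1]
  · have hle := (hsh t).2 ht
    have hle' : (s ((List.ofFn ε).take t.1) : ℝ) + 1 ≤ D h (τ ((List.ofFn ε).take t.1)) := by
      exact_mod_cast hle
    have habs := abs_le.mp (hclose h hh (τ ((List.ofFn ε).take t.1)))
    have hmul := mul_le_mul_of_nonneg_left hle' hα.le
    linarith [habs.2]
end
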